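/- arXiv:1205.1170 — 3 statements merged into one kernel-verified Lean document; each statement's English description precedes it below -/
import Mathlib

section
/- Every 1-2 metric space on at least 2 points either has at least n distinct lines (where n is the number of points) or has a line consisting of all n points. -/
def line {α : Type*} [MetricSpace α] (u v : α) : Set α :=
  {p | dist p u + dist u v = dist p v ∨ dist u p + dist p v = dist u v ∨
       dist u v + dist v p = dist u p}

def OneTwo (α : Type*) [MetricSpace α] : Prop :=
  ∀ x y : α, x ≠ y → dist x y = 1 ∨ dist x y = 2

def Twins {α : Type*} [MetricSpace α] (u v : α) : Prop :=
  dist u v = 2 ∧ ∀ w : α, w ≠ u → w ≠ v → dist u w = dist v w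

def linesOf (α : Type*) [MetricSpace α] : Set (Set α) :=
  {L | ∃ u v : α, u ≠ v ∧ L = line u v}


namespace OT

def inL {V : Type*} (A : V → V → Prop) (u v p : V) : Prop :=
  p = u ∨ p = v ∨ (A u v ∧ ¬ (A p u ↔ A p v)) ∨ (¬ A u v ∧ A p u ∧ A p v)

open Classical in
/-- the line through `u`, `v` in the subspace `S` -/
noncomputable def L {V : Type*} (A : V → V → Prop) (S : Finset V) (u v : V) : Finset V :=
  S.filter (inL A u v)

open Classical in
noncomputable def lines {V : Type*} (A : V → V → Prop) (S : Finset V) : Finset (Finset V) :=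
  S.offDiag.image (fun p => L A S p.1 p.2)

def Good {V : Type*} (A : V → V → Prop) (S : Finset V) : Prop :=
  S.card ≤ (lines A S).card ∨ ∃ u ∈ S, ∃ v ∈ S, u ≠ v ∧ ∀ p ∈ S, inL A u v p

section
variable {V : Type*} {A : V → V → Prop} {S : Finset V}

theorem mem_L {u v p : V} : p ∈ L A S u v ↔ p ∈ S ∧ inL A u v p := by
  classical
  simp [L]

theorem L_eq {u v a b : V} (h : L A S u v = L A S a b) (p : V) (hp : p ∈ S) :
    inL A u v p ↔ inL A a b p := by
  have := Finset.ext_iff.1 h p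
  simpa [mem_L, hp] using this

theorem L_comm (hs : ∀ x y, A x y → A y x) (u v : V) : L A S u v = L A S v u := by
  ext p
  have h1 := hs u v
  have h2 := hs v u
  simp only [mem_L, inL]
  grind

theorem mem_lines {T : Finset V} : T ∈ lines A S ↔
    ∃ u ∈ S, ∃ v ∈ S, u ≠ v ∧ L A S u v = T := by
  classical
  simp only [lines, Finset.mem_image, Finset.mem_offDiag, Prod.exists]
  grind

def TwinFree (A : V → V → Prop) (S : Finset V) : Prop :=
  ∀ u ∈ S, ∀ v ∈ S, u ≠ v → ¬ (∀ w ∈ S, A u w ↔ A v w)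

theorem match1 (hs : ∀ x y, A x y → A y x) (hi : ∀ x, ¬ A x x) (ht : TwinFree A S)
    {u v w : V} (hv : v ∈ S) (hw : w ∈ S)
    (h1 : A u v) (h2 : A u w) (h : L A S u v = L A S u w) : v = w := by
  by_contra hne
  refine ht v hv w hw hne ?_
  intro x hx
  have := L_eq h x hx
  have a1 := L_eq h v hv
  have a2 := L_eq h w hw
  simp only [inL] at this a1 a2
  have e1 := hi u; have e2 := hi v; have e3 := hi w
  have f1 : A x u ↔ A u x := ⟨hs _ _, hs _ _⟩
  have f2 : A x v ↔ A v x := ⟨hs _ _, hs _ _⟩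
  have f3 : A x w ↔ A w x := ⟨hs _ _, hs _ _⟩
  have f4 : A v w ↔ A w v := ⟨hs _ _, hs _ _⟩
  have f5 : A u w ↔ A w u := ⟨hs _ _, hs _ _⟩
  have f6 : A u v ↔ A v u := ⟨hs _ _, hs _ _⟩
  grind

theorem match2 (hs : ∀ x y, A x y → A y x)
    {u v w : V} (hv : v ∈ S) (h3 : u ≠ v)
    (h1 : ¬ A u v) (h2 : ¬ A u w) (h : L A S u v = L A S u w) : v = w := by
  have a1 := L_eq h v hv
  have f6 : A u v ↔ A v u := ⟨hs _ _, hs _ _⟩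
  simp only [inL] at a1
  grind

theorem meet (hs : ∀ x y, A x y → A y x)
    {a b c d : V} (ha : a ∈ S) (hc : c ∈ S) (hb : b ∈ S) 
    (h1 : A a b) (h2 : ¬ A c d) (h : L A S a b = L A S c d) :
    a = c ∨ a = d ∨ b = c ∨ b = d := by
  have a1 := L_eq h a ha
  have a2 := L_eq h b hb
  have a3 := L_eq h c hc
  have f1 : A a c ↔ A c a := ⟨hs _ _, hs _ _⟩
  have f2 : A b c ↔ A c b := ⟨hs _ _, hs _ _⟩
  simp only [inL] at a1 a2 a3
  grind

/-- an adjacent and a nonadjacent pair generating the same line -/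
def Mixed (A : V → V → Prop) (S : Finset V) (u v w : V) : Prop :=
  u ∈ S ∧ v ∈ S ∧ w ∈ S ∧ A u v ∧ u ≠ w ∧ ¬ A u w ∧ L A S u v = L A S u w

def CA (A : V → V → Prop) (S : Finset V) (u v w t : V) : Prop :=
  Mixed A S u v w ∧ t ∈ S ∧ t ≠ v ∧ A w t ∧ L A S w t = L A S u w

def CB (A : V → V → Prop) (S : Finset V) (u v w t : V) : Prop :=
  Mixed A S u v w ∧ t ∈ S ∧ t ≠ v ∧ ¬ A v t ∧ L A S v t = L A S u w

theorem mixed_vw (hi : ∀ x, ¬ A x x) {u v w : V}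
    (h : Mixed A S u v w) : A v w := by
  obtain ⟨hu, hv, hw, h1, h2, h3, h4⟩ := h
  have a1 := L_eq h4 v hv
  have := hi u
  simp only [inL] at a1
  grind


theorem CA_adj (hs : ∀ x y, A x y → A y x) (hi : ∀ x, ¬ A x x)
    {u v w t : V} (h : CA A S u v w t) :
    t ≠ u ∧ t ≠ w ∧ A v w ∧ A u t ∧ ¬ A v t := by
  obtain ⟨h, ht', htv, h1, h2⟩ := h
  have hvw := mixed_vw hi h
  obtain ⟨hu, hv, hw, k1, k2, k3, k4⟩ := h
  have e1 := hi u; have e2 := hi v; have e3 := hi w; have e4 := hi t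
  have b1 := L_eq k4 t ht'
  have b2 := L_eq h2 t ht'
  have b3 := L_eq h2 v hv
  simp only [inL] at b1 b2 b3
  grind

theorem CB_adj (hs : ∀ x y, A x y → A y x) (hi : ∀ x, ¬ A x x)
    {u v w t : V} (h : CB A S u v w t) :
    t ≠ u ∧ t ≠ w ∧ A v w ∧ A u t ∧ A w t := by
  obtain ⟨h, ht', htv, h1, h2⟩ := h
  have hvw := mixed_vw hi h
  obtain ⟨hu, hv, hw, k1, k2, k3, k4⟩ := h
  have e1 := hi u; have e2 := hi v; have e3 := hi w; have e4 := hi t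
  have b1 := L_eq h2 t ht'
  have b2 := L_eq h2 v hv
  have b3 := L_eq h2 u hu
  have b4 := L_eq h2 w hw
  simp only [inL] at b1 b2 b3 b4
  grind

theorem CA_out (hs : ∀ x y, A x y → A y x) (hi : ∀ x, ¬ A x x)
    {u v w t : V} (h : CA A S u v w t) (x : V) (hx : x ∈ S)
    (n1 : x ≠ u) (n2 : x ≠ v) (n3 : x ≠ w) (n4 : x ≠ t) :
    (A x u ∧ A x v ∧ ¬ A x w ∧ ¬ A x t) ∨ (¬ A x u ∧ ¬ A x v ∧ A x w ∧ A x t) ∨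
    (¬ A x u ∧ ¬ A x v ∧ ¬ A x w ∧ ¬ A x t) ∨ (A x u ∧ ¬ A x v ∧ A x w ∧ ¬ A x t) := by
  have h0 := CA_adj hs hi h
  obtain ⟨h, ht', htv, h1, h2⟩ := h
  obtain ⟨hu, hv, hw, k1, k2, k3, k4⟩ := h
  have b1 := L_eq k4 x hx
  have b2 := L_eq h2 x hx
  simp only [inL] at b1 b2
  grind

theorem CB_out (hs : ∀ x y, A x y → A y x) (hi : ∀ x, ¬ A x x)
    {u v w t : V} (h : CB A S u v w t) (x : V) (hx : x ∈ S)
    (n1 : x ≠ u) (n2 : x ≠ v) (n3 : x ≠ w) (n4 : x ≠ t) :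
    (A x u ∧ A x v ∧ ¬ A x w ∧ ¬ A x t) ∨ (¬ A x u ∧ ¬ A x v) := by
  have h0 := CB_adj hs hi h
  obtain ⟨h, ht', htv, h1, h2⟩ := h
  obtain ⟨hu, hv, hw, k1, k2, k3, k4⟩ := h
  have b1 := L_eq k4 x hx
  have b2 := L_eq h2 x hx
  simp only [inL] at b1 b2
  grind

theorem CA_symm (hs : ∀ x y, A x y → A y x)
    {u v w t : V} (h : CA A S u v w t) : CA A S w t u v := by
  obtain ⟨⟨hu, hv, hw, k1, k2, k3, k4⟩, ht', htv, h1, h2⟩ := h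
  have e := L_comm (S := S) hs u w
  exact ⟨⟨hw, ht', hu, h1, k2.symm, fun h => k3 (hs _ _ h), h2.trans e⟩, hv, htv.symm, k1,
    k4.trans e⟩

theorem sig_lemma {u v w t z c z' c' : V} {N N' q1 q2 q3 q4 : Prop}
    (a4 : (z = u ∧ c = v ∧ q1 ∧ q2 ∧ q3 ∧ q4) ∨ (N ∧
      ((c = u ∧ q1 ∧ ¬ q2 ∧ ¬ q3 ∧ ¬ q4) ∨ (c = v ∧ ¬ q1 ∧ q2 ∧ ¬ q3 ∧ ¬ q4) ∨
       (c = w ∧ ¬ q1 ∧ ¬ q2 ∧ q3 ∧ ¬ q4) ∨ (c = t ∧ ¬ q1 ∧ ¬ q2 ∧ ¬ q3 ∧ q4) ∨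
       (c = t ∧ q1 ∧ ¬ q2 ∧ ¬ q3 ∧ q4) ∨ (c = w ∧ ¬ q1 ∧ q2 ∧ q3 ∧ ¬ q4) ∨
       (c = v ∧ q1 ∧ q2 ∧ q3 ∧ ¬ q4))))
    (b4 : (z' = u ∧ c' = v ∧ q1 ∧ q2 ∧ q3 ∧ q4) ∨ (N' ∧
      ((c' = u ∧ q1 ∧ ¬ q2 ∧ ¬ q3 ∧ ¬ q4) ∨ (c' = v ∧ ¬ q1 ∧ q2 ∧ ¬ q3 ∧ ¬ q4) ∨
       (c' = w ∧ ¬ q1 ∧ ¬ q2 ∧ q3 ∧ ¬ q4) ∨ (c' = t ∧ ¬ q1 ∧ ¬ q2 ∧ ¬ q3 ∧ q4) ∨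
       (c' = t ∧ q1 ∧ ¬ q2 ∧ ¬ q3 ∧ q4) ∨ (c' = w ∧ ¬ q1 ∧ q2 ∧ q3 ∧ ¬ q4) ∨
       (c' = v ∧ q1 ∧ q2 ∧ q3 ∧ ¬ q4)))) :
    c = c' ∧ ((z = u ∧ z' = u) ∨ (N ∧ N')) := by
  by_cases h1 : q1 <;> by_cases h2 : q2 <;> by_cases h3 : q3 <;> by_cases h4 : q4 <;>
    simp only [h1, h2, h3, h4, not_true_eq_false, not_false_eq_true, and_true, and_false,
      true_and, false_and, or_false, false_or] at a4 b4 <;> grind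

set_option maxHeartbeats 1000000 in
open Classical in
theorem CA_good_aux (hs : ∀ x y, A x y → A y x) (hi : ∀ x, ¬ A x x)
    {u v w t : V} (h : CA A S u v w t)
    (hpq : (S.filter (fun x => A x w ∧ A x t)).card ≤ (S.filter (fun x => A x u ∧ A x v)).card) :
    Good A S := by
  have hadj := CA_adj hs hi h
  have hout := CA_out hs hi h
  obtain ⟨⟨hu, hv, hw, k1, k2, k3, k4⟩, htS, htv, h1, h2⟩ := h
  obtain ⟨g1, g2, g3, g4, g5⟩ := hadj
  have e1 := hi u; have e2 := hi v; have e3 := hi w; have e4 := hi t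
  have j1 := hs _ _ k1
  have j2 := hs _ _ h1
  have j3 := hs _ _ g3
  have j4 := hs _ _ g4
  have j5 : ¬ A w u := fun h => k3 (hs _ _ h)
  have j6 : ¬ A t v := fun h => g5 (hs _ _ h)
  have nuv : u ≠ v := fun h => e1 (h ▸ k1)
  have nvw : v ≠ w := fun h => e2 (h ▸ g3)
  by_cases hO : ∃ z ∈ S, z ≠ u ∧ z ≠ v ∧ z ≠ w ∧ z ≠ t ∧
      ¬ A z u ∧ ¬ A z v ∧ ¬ A z w ∧ ¬ A z t
  swap
  · right
    refine ⟨v, hv, w, hw, nvw, ?_⟩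
    intro p hp
    have := hout p hp
    simp only [inL]
    by_contra hc
    apply hO
    refine ⟨p, hp, ?_⟩
    clear hpq hout hO
    by_cases p1 : p = u
    · subst p1; grind
    by_cases p2 : p = v
    · subst p2; grind
    by_cases p3 : p = w
    · subst p3; grind
    by_cases p4 : p = t
    · subst p4; grind
    rcases this p1 p2 p3 p4 with h | h | h | h <;> grind
  left
  set O := S.filter (fun x => (x ≠ u ∧ x ≠ v ∧ x ≠ w ∧ x ≠ t) ∧
      ¬ A x u ∧ ¬ A x v ∧ ¬ A x w ∧ ¬ A x t) with hOdef
  set P := S.filter (fun x => A x u ∧ A x v) with hP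
  set Q := S.filter (fun x => A x w ∧ A x t) with hQ
  set X := S.filter (fun x => (x ≠ v ∧ x ≠ t) ∧ A x u ∧ A x w) with hX
  have hOpos : 0 < O.card := by
    obtain ⟨z, hz, hz'⟩ := hO
    refine Finset.card_pos.2 ⟨z, ?_⟩
    rw [hOdef, Finset.mem_filter]
    grind
  have hcov : S ⊆ {u, v, w, t} ∪ O ∪ P ∪ Q ∪ X := by
    intro p hp
    have := hout p hp
    simp only [Finset.mem_union, Finset.mem_insert, Finset.mem_singleton, hOdef, hP, hQ, hX,
      Finset.mem_filter]
    grind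
  have hcard : S.card ≤ 4 + O.card + P.card + Q.card + X.card := by
    have c0 := Finset.card_le_card hcov
    have c1 := Finset.card_union_le ({u, v, w, t} ∪ O ∪ P ∪ Q) X
    have c2 := Finset.card_union_le ({u, v, w, t} ∪ O ∪ P) Q
    have c3 := Finset.card_union_le ({u, v, w, t} ∪ O) P
    have c4 := Finset.card_union_le {u, v, w, t} O
    have c5 : ({u, v, w, t} : Finset V).card ≤ 4 := Finset.card_le_four
    omega
  have mO : ∀ x, x ∈ O → x ∈ S ∧ (x ≠ u ∧ x ≠ v ∧ x ≠ w ∧ x ≠ t) ∧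
      ¬ A x u ∧ ¬ A x v ∧ ¬ A x w ∧ ¬ A x t := fun x hx => by simpa [hOdef] using hx
  have mP : ∀ x, x ∈ P → x ∈ S ∧ (x ≠ u ∧ x ≠ v ∧ x ≠ w ∧ x ≠ t) ∧
      A x u ∧ A x v ∧ ¬ A x w ∧ ¬ A x t := fun x hx => by
    rw [hP, Finset.mem_filter] at hx
    have := hout x hx.1
    obtain ⟨x1, x2⟩ := hx
    clear hpq hcov hcard hOpos hO hout mO
    clear_value O P Q X
    clear hOdef hP hQ hX
    have n1 : x ≠ u := by rintro rfl; tauto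
    have n2 : x ≠ v := by rintro rfl; tauto
    have n3 : x ≠ w := by rintro rfl; tauto
    have n4 : x ≠ t := by rintro rfl; tauto
    have := this n1 n2 n3 n4
    tauto
  have mX : ∀ x, x ∈ X → x ∈ S ∧ (x ≠ u ∧ x ≠ v ∧ x ≠ w ∧ x ≠ t) ∧
      A x u ∧ ¬ A x v ∧ A x w ∧ ¬ A x t := fun x hx => by
    rw [hX, Finset.mem_filter] at hx
    have := hout x hx.1
    obtain ⟨x1, x2⟩ := hx
    clear hpq hcov hcard hOpos hO hout mO mP
    clear_value O P Q X
    clear hOdef hP hQ hX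
    have n1 : x ≠ u := by rintro rfl; tauto
    have n3 : x ≠ w := by rintro rfl; tauto
    have := this n1 x2.1.1 n3 x2.1.2
    tauto
  let D : Finset (V × V) := ((O ×ˢ {u, v, w, t} ∪ P ×ˢ {t, w}) ∪ X ×ˢ {v}) ∪ {(u, v)}
  have hD : D.card = 4 * O.card + 2 * P.card + X.card + 1 := by
    have q4 : ({u, v, w, t} : Finset V).card = 4 := by
      rw [Finset.card_insert_of_notMem, Finset.card_insert_of_notMem,
        Finset.card_insert_of_notMem, Finset.card_singleton] <;> simp <;> grind
    have q2 : ({t, w} : Finset V).card = 2 := Finset.card_pair g2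
    rw [Finset.card_union_of_disjoint, Finset.card_union_of_disjoint,
      Finset.card_union_of_disjoint, Finset.card_product, Finset.card_product,
      Finset.card_product, q4, q2, Finset.card_singleton, Finset.card_singleton]
    · ring
    · rw [Finset.disjoint_left]
      rintro ⟨a, b⟩ ha hb
      have ha := mO a (Finset.mem_product.1 ha).1
      have hb := mP a (Finset.mem_product.1 hb).1
      exact ha.2.2.1 hb.2.2.1
    · rw [Finset.disjoint_left]
      rintro ⟨a, b⟩ ha hb
      have hb := mX a (Finset.mem_product.1 hb).1
      rcases Finset.mem_union.1 ha with ha | ha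
      · have ha := mO a (Finset.mem_product.1 ha).1
        exact ha.2.2.1 hb.2.2.1
      · have ha := mP a (Finset.mem_product.1 ha).1
        exact hb.2.2.2.1 ha.2.2.2.1
    · rw [Finset.disjoint_right]
      rintro ⟨a, b⟩ hb ha
      have hb := (Prod.mk.inj (Finset.mem_singleton.1 hb)).1
      subst hb
      rcases Finset.mem_union.1 ha with ha | ha
      · rcases Finset.mem_union.1 ha with ha | ha
        · exact (mO a (Finset.mem_product.1 ha).1).2.1.1 rfl
        · exact (mP a (Finset.mem_product.1 ha).1).2.1.1 rfl
      · exact (mX a (Finset.mem_product.1 ha).1).2.1.1 rfl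
  have hsig : ∀ z c, (z, c) ∈ D → (z ∈ S ∧ c ∈ S ∧ z ≠ c) ∧
      ((z = u ∧ c = v ∧ inL A z c u ∧ inL A z c v ∧ inL A z c w ∧ inL A z c t) ∨ (¬ A c z ∧
      ((c = u ∧ inL A z c u ∧ ¬ inL A z c v ∧ ¬ inL A z c w ∧ ¬ inL A z c t) ∨
       (c = v ∧ ¬ inL A z c u ∧ inL A z c v ∧ ¬ inL A z c w ∧ ¬ inL A z c t) ∨
       (c = w ∧ ¬ inL A z c u ∧ ¬ inL A z c v ∧ inL A z c w ∧ ¬ inL A z c t) ∨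
       (c = t ∧ ¬ inL A z c u ∧ ¬ inL A z c v ∧ ¬ inL A z c w ∧ inL A z c t) ∨
       (c = t ∧ inL A z c u ∧ ¬ inL A z c v ∧ ¬ inL A z c w ∧ inL A z c t) ∨
       (c = w ∧ ¬ inL A z c u ∧ inL A z c v ∧ inL A z c w ∧ ¬ inL A z c t) ∨
       (c = v ∧ inL A z c u ∧ inL A z c v ∧ inL A z c w ∧ ¬ inL A z c t)))) := by
    clear hcov hcard hD hOpos hpq hout hO
    intro z c hzc
    simp only [D, Finset.mem_union, Finset.mem_product, Finset.mem_insert,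
      Finset.mem_singleton, Prod.mk.injEq] at hzc
    clear_value O P Q X
    have fu := hs z u; have fv := hs z v; have fw := hs z w; have ft := hs z t
    have fu' := hs u z; have fv' := hs v z; have fw' := hs w z; have ft' := hs t z
    rcases hzc with ((⟨hz, hc⟩ | ⟨hz, hc⟩) | ⟨hz, hc⟩) | ⟨hz, hc⟩
    · obtain ⟨m1, ⟨m2, m3, m4, m5⟩, m6, m7, m8, m9⟩ := mO z hz
      clear mO mP mX
      rcases hc with hc | hc | hc | hc <;> subst hc <;> simp only [inL] <;> simp_all <;> grind
    · obtain ⟨m1, ⟨m2, m3, m4, m5⟩, m6, m7, m8, m9⟩ := mP z hz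
      clear mO mP mX
      rcases hc with hc | hc <;> subst hc <;> simp only [inL] <;> simp_all <;> grind
    · obtain ⟨m1, ⟨m2, m3, m4, m5⟩, m6, m7, m8, m9⟩ := mX z hz
      clear mO mP mX
      subst hc
      simp only [inL] ; simp_all ; grind
    · clear mO mP mX
      subst hz hc
      simp only [inL] ; simp_all
  have hle : D.card ≤ (lines A S).card := by
    apply Finset.card_le_card_of_injOn (fun p => L A S p.1 p.2)
    · rintro ⟨z, c⟩ hz
      obtain ⟨⟨a1, a2, a3⟩, -⟩ := hsig z c hz
      exact mem_lines.2 ⟨z, a1, c, a2, a3, rfl⟩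
    · rintro ⟨z, c⟩ hz ⟨z', c'⟩ hz' heq
      simp only at heq
      obtain ⟨⟨a1, a2, a3⟩, a4⟩ := hsig z c hz
      obtain ⟨⟨b1, b2, b3⟩, b4⟩ := hsig z' c' hz'
      have l1 := L_eq heq u hu
      have l2 := L_eq heq v hv
      have l3 := L_eq heq w hw
      have l4 := L_eq heq t htS
      rw [← l1, ← l2, ← l3, ← l4] at b4
      have key := sig_lemma a4 b4
      obtain ⟨rfl, k | ⟨k, k'⟩⟩ := key
      · rw [k.1, k.2]
      · have : z = z' := match2 hs a1 (Ne.symm a3) k k' (by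
          rw [L_comm hs c z, L_comm hs c z', heq])
        rw [this]
  omega

theorem CA_good (hs : ∀ x y, A x y → A y x) (hi : ∀ x, ¬ A x x)
    {u v w t : V} (h : CA A S u v w t) : Good A S := by
  classical
  rcases le_total (S.filter (fun x => A x w ∧ A x t)).card
    (S.filter (fun x => A x u ∧ A x v)).card with h' | h'
  · exact CA_good_aux hs hi h (by convert h')
  · exact CA_good_aux hs hi (CA_symm hs h) (by convert h')


set_option maxHeartbeats 1000000 in
theorem CB_small (hs : ∀ x y, A x y → A y x) (hi : ∀ x, ¬ A x x) (ht : TwinFree A S)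
    {u v w t x y : V} (h : CB A S u v w t) (hx : x ∈ S) (hy : y ∈ S)
    (hcov : ∀ p ∈ S, p = u ∨ p = v ∨ p = w ∨ p = t ∨ p = x ∨ p = y)
    (hA : ¬ CA A S u v w t) :
    ∃ u ∈ S, ∃ v ∈ S, u ≠ v ∧ ∀ p ∈ S, inL A u v p := by
  have hadj := CB_adj hs hi h
  have hout := CB_out hs hi h
  have hmix := h.1
  obtain ⟨⟨hu, hv, hw, k1, k2, k3, k4⟩, htS, htv, h1, h2⟩ := h
  obtain ⟨g1, g2, g3, g4, g5⟩ := hadj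
  have e1 := hi u; have e2 := hi v; have e3 := hi w; have e4 := hi t
  have j1 := hs _ _ k1
  have j2 := hs _ _ g5
  have j3 := hs _ _ g3
  have j4 := hs _ _ g4
  have j5 : ¬ A w u := fun h => k3 (hs _ _ h)
  have j6 : ¬ A t v := fun h => h1 (hs _ _ h)
  have nuv : u ≠ v := fun h => e1 (h ▸ k1)
  have nvw : v ≠ w := fun h => e2 (h ▸ g3)
  by_contra hno
  have hU : ∀ a ∈ S, ∀ b ∈ S, a ≠ b → ∃ p ∈ S, ¬ inL A a b p := by
    intro a ha b hb hab
    by_contra hc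
    push Not at hc
    exact hno ⟨a, ha, b, hb, hab, hc⟩
  have hA' : ∃ p ∈ S, ¬ (inL A w t p ↔ inL A u w p) := by
    by_contra hc
    push Not at hc
    apply hA
    refine ⟨hmix, htS, htv, g5, ?_⟩
    ext p
    rw [mem_L, mem_L]
    exact and_congr_right (hc p)
  obtain ⟨p1, m1, r1⟩ := hU v hv w hw nvw
  obtain ⟨p2, m2, r2⟩ := hU u hu t htS g1.symm
  obtain ⟨p3, m3, r3⟩ := hU w hw t htS g2.symm
  obtain ⟨p4, m4, r4⟩ := hA'
  have T1 := ht u hu w hw k2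
  have T2 := ht v hv t htS htv.symm
  push Not at T1 T2
  obtain ⟨p5, m5, r5⟩ := T1
  obtain ⟨p6, m6, r6⟩ := T2
  have c1 := hcov p1 m1
  have c2 := hcov p2 m2
  have c3 := hcov p3 m3
  have c4 := hcov p4 m4
  have c5 := hcov p5 m5
  have c6 := hcov p6 m6
  clear hcov hU hno hA hmix k4 h2
  simp only [inL] at r1 r2 r3 r4
  have w1 : p1 = x ∨ p1 = y := by
    rcases c1 with h | h | h | h | h | h <;> subst h <;> simp_all
  have w2 : p2 = x ∨ p2 = y := by
    rcases c2 with h | h | h | h | h | h <;> subst h <;> simp_all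
  have w3 : p3 = x ∨ p3 = y := by
    rcases c3 with h | h | h | h | h | h <;> subst h <;> simp_all
  have w4 : p4 = x ∨ p4 = y := by
    rcases c4 with h | h | h | h | h | h <;> subst h <;> simp_all
  have w5 : p5 = x ∨ p5 = y := by
    rcases c5 with h | h | h | h | h | h <;> subst h <;> simp_all
  have w6 : p6 = x ∨ p6 = y := by
    rcases c6 with h | h | h | h | h | h <;> subst h <;> simp_all
  clear c1 c2 c3 c4 c5 c6
  have o1 := hout p1 m1
  have o2 := hout p2 m2
  have o3 := hout p3 m3
  have o4 := hout p4 m4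
  have o5 := hout p5 m5
  have o6 := hout p6 m6
  clear hout
  have z1 : ¬ A p1 u ∧ ¬ A p1 v ∧ ¬ A p1 w := by
    clear o2 o3 o4 o5 o6 r2 r3 r4 r5 r6
    by_cases n1 : p1 = u
    · subst n1; simp_all
    by_cases n2 : p1 = t
    · subst n2; simp_all
    push Not at r1
    have := o1 n1 r1.1 r1.2.1 n2
    have r1 := r1.2.2
    clear * - r1 this g3
    tauto
  have z2 : ¬ A p2 u ∧ ¬ A p2 v ∧ ¬ A p2 t := by
    clear o1 o3 o4 o5 o6 r1 r3 r4 r5 r6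
    by_cases n1 : p2 = v
    · subst n1; simp_all
    by_cases n2 : p2 = w
    · subst n2; simp_all
    push Not at r2
    have := o2 r2.1 n1 n2 r2.2.1
    have r2 := r2.2.2
    clear * - r2 this g4
    tauto
  have z3 : A p3 w ↔ A p3 t := by
    clear * - r3 g5
    tauto
  have z4 : ¬ A p4 u ∧ ¬ A p4 v ∧ ¬ (A p4 w ↔ A p4 t) := by
    clear o1 o2 o3 o5 o6 r1 r2 r3 r5 r6
    by_cases n1 : p4 = u
    · subst n1; simp_all
    by_cases n2 : p4 = v
    · subst n2; simp_all
    by_cases n3 : p4 = w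
    · subst n3; simp_all
    by_cases n4 : p4 = t
    · subst n4; simp_all
    have := o4 n1 n2 n3 n4
    simp only [n1, n2, n3, n4, k3, g5, false_or, true_and, false_and, or_false,
      not_true_eq_false, not_false_eq_true] at r4
    clear * - r4 this
    tauto
  have y5 : ¬ (A p5 u ↔ A p5 w) := by
    have a1 := hs u p5; have a2 := hs p5 u; have a3 := hs w p5; have a4 := hs p5 w
    clear * - a1 a2 a3 a4 r5
    tauto
  have y6 : ¬ (A p6 v ↔ A p6 t) := by
    have a1 := hs v p6; have a2 := hs p6 v; have a3 := hs t p6; have a4 := hs p6 t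
    clear * - a1 a2 a3 a4 r6
    tauto
  clear * - z1 z2 z3 z4 y5 y6 w1 w2 w3 w4 w5 w6
  rcases w4 with rfl | rfl <;> rcases w1 with rfl | rfl <;> rcases w2 with rfl | rfl <;>
    rcases w3 with rfl | rfl <;> rcases w5 with rfl | rfl <;> rcases w6 with rfl | rfl <;>
    first | exact absurd z3 z4.2.2 | grind

theorem mixed_small (hs : ∀ x y, A x y → A y x) (hi : ∀ x, ¬ A x x) (ht : TwinFree A S)
    {u v w x : V} (h : Mixed A S u v w) (hx : x ∈ S)
    (hcov : ∀ p ∈ S, p = u ∨ p = v ∨ p = w ∨ p = x) :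
    ∃ u ∈ S, ∃ v ∈ S, u ≠ v ∧ ∀ p ∈ S, inL A u v p := by
  have g3 := mixed_vw hi h
  obtain ⟨hu, hv, hw, k1, k2, k3, k4⟩ := h
  have e1 := hi u; have e2 := hi v; have e3 := hi w
  have j1 := hs _ _ k1
  have j3 := hs _ _ g3
  have j5 : ¬ A w u := fun h => k3 (hs _ _ h)
  have nvw : v ≠ w := fun h => e2 (h ▸ g3)
  have T1 := ht u hu w hw k2
  push Not at T1
  obtain ⟨p5, m5, r5⟩ := T1
  have hp5 : p5 = x := by
    rcases hcov p5 m5 with h | h | h | h <;> subst h <;> simp_all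
  subst hp5
  have b1 := L_eq k4 p5 hx
  have f1 : A p5 u ↔ A u p5 := ⟨hs _ _, hs _ _⟩
  have f2 : A p5 w ↔ A w p5 := ⟨hs _ _, hs _ _⟩
  have n1 : p5 ≠ u := by rintro rfl; simp_all
  have n2 : p5 ≠ v := by rintro rfl; simp_all
  have n3 : p5 ≠ w := by rintro rfl; simp_all
  refine ⟨v, hv, w, hw, nvw, ?_⟩
  intro p hp
  simp only [inL] at b1 ⊢
  rcases hcov p hp with h | h | h | h
  · subst h; simp_all
  · exact Or.inl h
  · exact Or.inr (Or.inl h)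
  · subst h; simp only [n1, n2, n3, false_or, k1, k3, g3] at b1 ⊢
    clear hcov m5 k4 ht
    grind

open Classical in
theorem fiber (hs : ∀ x y, A x y → A y x) (hi : ∀ x, ¬ A x x) (ht : TwinFree A S)
    (hA : ∀ u v w t, ¬ CA A S u v w t) (ℓ : Finset V) :
    (S.offDiag.filter (fun p => L A S p.1 p.2 = ℓ)).card ≤ ℓ.card ∨
    ((∃ u v w, Mixed A S u v w) ∧
      (S.offDiag.filter (fun p => L A S p.1 p.2 = ℓ)).card ≤ 4) ∨
    ((∃ u v w t, CB A S u v w t) ∧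
      (S.offDiag.filter (fun p => L A S p.1 p.2 = ℓ)).card ≤ 6) := by
  set F := S.offDiag.filter (fun p => L A S p.1 p.2 = ℓ) with hF
  have mF : ∀ a b, (a, b) ∈ F ↔ (a ∈ S ∧ b ∈ S ∧ a ≠ b) ∧ L A S a b = ℓ := by
    intro a b; simp [hF]
  clear_value F
  have inj : (∀ a b c, (a, b) ∈ F → (a, c) ∈ F → b = c) → F.card ≤ ℓ.card := by
    intro h
    apply Finset.card_le_card_of_injOn Prod.fst
    · rintro ⟨a, b⟩ hab
      have := (mF a b).1 hab
      simp only [← this.2, Finset.mem_coe, mem_L, inL]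
      exact ⟨this.1.1, by simp⟩
    · rintro ⟨a, b⟩ hab ⟨a', c⟩ hac heq
      simp only at heq
      subst heq
      rw [h a b c hab hac]
  by_cases h1 : ∃ a b, (a, b) ∈ F ∧ A a b
  swap
  · left
    apply inj
    intro a b c hab hac
    have q1 : ¬ A a b := fun h => h1 ⟨a, b, hab, h⟩
    have q2 : ¬ A a c := fun h => h1 ⟨a, c, hac, h⟩
    rw [mF] at hab hac
    exact match2 hs hab.1.2.1 hab.1.2.2 q1 q2 (hab.2.trans hac.2.symm)
  by_cases h2 : ∃ a b, (a, b) ∈ F ∧ ¬ A a b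
  swap
  · left
    apply inj
    intro a b c hab hac
    have q1 : A a b := by_contra fun h => h2 ⟨a, b, hab, h⟩
    have q2 : A a c := by_contra fun h => h2 ⟨a, c, hac, h⟩
    rw [mF] at hab hac
    exact match1 hs hi ht hab.1.2.1 hac.1.2.1 q1 q2 (hab.2.trans hac.2.symm)
  right
  have sw : ∀ a b, (a, b) ∈ F → (b, a) ∈ F := by
    intro a b hab
    rw [mF] at hab ⊢
    exact ⟨⟨hab.1.2.1, hab.1.1, hab.1.2.2.symm⟩, (L_comm hs b a).trans hab.2⟩
  have hm : ∃ u v w, (u, v) ∈ F ∧ (u, w) ∈ F ∧ A u v ∧ ¬ A u w := by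
    obtain ⟨a, b, hab, q1⟩ := h1
    obtain ⟨c, d, hcd, q2⟩ := h2
    have y1 := (mF a b).1 hab
    have y2 := (mF c d).1 hcd
    have q1' := hs _ _ q1
    have q2' : ¬ A d c := fun h => q2 (hs _ _ h)
    rcases meet hs y1.1.1 y2.1.1 y1.1.2.1 q1 q2 (y1.2.trans y2.2.symm) with h | h | h | h
    · subst h; exact ⟨a, b, d, hab, hcd, q1, q2⟩
    · subst h; exact ⟨a, b, c, hab, sw _ _ hcd, q1, q2'⟩
    · subst h; exact ⟨b, a, d, sw _ _ hab, hcd, q1', q2⟩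
    · subst h; exact ⟨b, a, c, sw _ _ hab, sw _ _ hcd, q1', q2'⟩
  obtain ⟨u, v, w, huv, huw, q1, q2⟩ := hm
  have y1 := (mF u v).1 huv
  have y2 := (mF u w).1 huw
  have hM : Mixed A S u v w :=
    ⟨y1.1.1, y1.1.2.1, y2.1.2.1, q1, y2.1.2.2, q2, y1.2.trans y2.2.symm⟩
  have hvw := mixed_vw hi hM
  have F1w : ∀ b, (w, b) ∈ F → ¬ A w b := by
    intro b hb hab
    have y3 := (mF w b).1 hb
    by_cases hbv : b = v
    · subst hbv
      have := match1 hs hi ht y1.1.1 y3.1.1 (hs _ _ q1) hvw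
        ((L_comm hs b u).trans (y1.2.trans (y3.2.symm.trans (L_comm hs w b))))
      exact y2.1.2.2 this
    · exact hA u v w b ⟨hM, y3.1.2.1, hbv, hab, y3.2.trans y2.2.symm⟩
  have F1u : ∀ b, (u, b) ∈ F → A u b → b = v := by
    intro b hb hab
    have y3 := (mF u b).1 hb
    exact match1 hs hi ht y3.1.2.1 y1.1.2.1 hab q1 (y3.2.trans y1.2.symm)
  have F2u : ∀ b, (u, b) ∈ F → ¬ A u b → b = w := by
    intro b hb hab
    have y3 := (mF u b).1 hb
    exact match2 hs y3.1.2.1 y3.1.2.2 hab q2 (y3.2.trans y2.2.symm)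
  have F1 : ∀ a b, (a, b) ∈ F → A a b → (a, b) = (u, v) ∨ (a, b) = (v, u) := by
    intro a b hab q
    have y3 := (mF a b).1 hab
    rcases meet hs y3.1.1 y2.1.1 y3.1.2.1 q q2 (y3.2.trans y2.2.symm) with h | h | h | h
    · subst h; left; rw [F1u b hab q]
    · subst h; exact absurd q (F1w b hab)
    · subst h; right; rw [F1u a (sw _ _ hab) (hs _ _ q)]
    · subst h; exact absurd (hs _ _ q) (F1w a (sw _ _ hab))
  have F2 : ∀ a b, (a, b) ∈ F → ¬ A a b →
      (a, b) = (u, w) ∨ (a, b) = (w, u) ∨ a = v ∨ b = v := by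
    intro a b hab q
    have y3 := (mF a b).1 hab
    have q' : ¬ A b a := fun h => q (hs _ _ h)
    rcases meet hs y1.1.1 y3.1.1 y1.1.2.1 q1 q (y1.2.trans y3.2.symm) with h | h | h | h
    · subst h; left; rw [F2u b hab q]
    · subst h; right; left; rw [F2u a (sw _ _ hab) q']
    · exact Or.inr (Or.inr (Or.inl h.symm))
    · exact Or.inr (Or.inr (Or.inr h.symm))
  by_cases hB : ∃ t, (v, t) ∈ F ∧ ¬ A v t
  · right
    obtain ⟨t, hvt, q3⟩ := hB
    have y4 := (mF v t).1 hvt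
    refine ⟨⟨u, v, w, t, hM, y4.1.2.1, y4.1.2.2.symm, q3, y4.2.trans y2.2.symm⟩, ?_⟩
    have F2v : ∀ b, (v, b) ∈ F → ¬ A v b → b = t := by
      intro b hb hab
      have y3 := (mF v b).1 hb
      exact match2 hs y3.1.2.1 y3.1.2.2 hab q3 (y3.2.trans y4.2.symm)
    have hsub : F ⊆ {(u, v), (v, u), (u, w), (w, u), (v, t), (t, v)} := by
      rintro ⟨a, b⟩ hab
      simp only [Finset.mem_insert, Finset.mem_singleton]
      by_cases q : A a b
      · rcases F1 a b hab q with h | h <;> simp [h]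
      · rcases F2 a b hab q with h | h | h | h
        · simp [h]
        · simp [h]
        · subst h; simp [F2v b hab q]
        · subst h; simp [F2v a (sw _ _ hab) (fun h => q (hs _ _ h))]
    exact (Finset.card_le_card hsub).trans Finset.card_le_six
  · left
    refine ⟨⟨u, v, w, hM⟩, ?_⟩
    have hsub : F ⊆ {(u, v), (v, u), (u, w), (w, u)} := by
      rintro ⟨a, b⟩ hab
      simp only [Finset.mem_insert, Finset.mem_singleton]
      by_cases q : A a b
      · rcases F1 a b hab q with h | h <;> simp [h]
      · rcases F2 a b hab q with h | h | h | h
        · simp [h]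
        · simp [h]
        · subst h; exact absurd ⟨b, hab, q⟩ hB
        · subst h; exact absurd ⟨a, sw _ _ hab, fun h => q (hs _ _ h)⟩ hB
    exact (Finset.card_le_card hsub).trans Finset.card_le_four

theorem twinfree_good (hs : ∀ x y, A x y → A y x) (hi : ∀ x, ¬ A x x) (ht : TwinFree A S)
    (hn : 2 ≤ S.card) : Good A S := by
  classical
  by_contra hG
  have hA : ∀ u v w t, ¬ CA A S u v w t := fun u v w t h => hG (CA_good hs hi h)
  have hU : ¬ ∃ u ∈ S, ∃ v ∈ S, u ≠ v ∧ ∀ p ∈ S, inL A u v p := fun h => hG (Or.inr h)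
  apply hG
  left
  have hlt : ∀ ℓ ∈ lines A S, ℓ.card ≤ S.card - 1 := by
    intro ℓ hℓ
    obtain ⟨u, hu, v, hv, huv, rfl⟩ := mem_lines.1 hℓ
    have hss : L A S u v ⊂ S := by
      rw [Finset.ssubset_iff_subset_ne]
      refine ⟨fun p hp => (mem_L.1 hp).1, fun h => hU ⟨u, hu, v, hv, huv, fun p hp => ?_⟩⟩
      rw [← h] at hp
      exact (mem_L.1 hp).2
    have := Finset.card_lt_card hss
    omega
  have key : ∀ ℓ ∈ lines A S,
      (S.offDiag.filter (fun p => L A S p.1 p.2 = ℓ)).card ≤ S.card - 1 := by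
    intro ℓ hℓ
    have h0 := hlt ℓ hℓ
    rcases fiber hs hi ht hA ℓ with h | ⟨⟨u, v, w, hM⟩, h⟩ | ⟨⟨u, v, w, t, hB⟩, h⟩
    · omega
    · by_contra hc
      apply hU
      have h3 : ({u, v, w} : Finset V).card = 3 := by
        have hvw := mixed_vw hi hM
        obtain ⟨hu, hv, hw, k1, k2, k3, k4⟩ := hM
        refine Finset.card_eq_three.2 ⟨u, v, w, ?_, k2, ?_, rfl⟩
        · rintro rfl; exact hi _ k1
        · rintro rfl; exact hi _ hvw
      have hd : (S \ {u, v, w}).card ≤ 1 := by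
        rw [Finset.card_sdiff_of_subset, h3]
        · omega
        · intro p; simp only [Finset.mem_insert, Finset.mem_singleton]
          rintro (rfl | rfl | rfl)
          exacts [hM.1, hM.2.1, hM.2.2.1]
      have : ∃ x ∈ S, ∀ p ∈ S \ {u, v, w}, p = x := by
        rcases (S \ {u, v, w}).eq_empty_or_nonempty with he | ⟨x, hx⟩
        · exact ⟨u, hM.1, by simp [he]⟩
        · exact ⟨x, (Finset.mem_sdiff.1 hx).1, fun p hp => Finset.card_le_one.1 hd p hp x hx⟩
      obtain ⟨x, hx, hp⟩ := this
      refine mixed_small hs hi ht hM hx ?_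
      intro p hpS
      by_contra hcc
      push Not at hcc
      refine hcc.2.2.2 (hp p ?_)
      simp [hpS, hcc]
    · by_contra hc
      apply hU
      have hadj := CB_adj hs hi hB
      have hsub : ({u, v, w, t} : Finset V) ⊆ S := by
        intro p; simp only [Finset.mem_insert, Finset.mem_singleton]
        rintro (rfl | rfl | rfl | rfl)
        exacts [hB.1.1, hB.1.2.1, hB.1.2.2.1, hB.2.1]
      have h3 : ({u, v, w, t} : Finset V).card = 4 := by
        obtain ⟨⟨hu, hv, hw, k1, k2, k3, k4⟩, ht1, ht2, -⟩ := hB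
        have n1 : u ≠ v := by rintro rfl; exact hi _ k1
        have n2 : v ≠ w := by rintro rfl; exact hi _ hadj.2.2.1
        rw [Finset.card_insert_of_notMem, Finset.card_insert_of_notMem,
          Finset.card_insert_of_notMem, Finset.card_singleton] <;> simp
        · exact hadj.2.1.symm
        · exact ⟨n2, ht2.symm⟩
        · exact ⟨n1, k2, hadj.1.symm⟩
      have hd : (S \ {u, v, w, t}).card ≤ 2 := by
        rw [Finset.card_sdiff_of_subset hsub, h3]
        omega
      have : ∃ x ∈ S, ∃ y ∈ S, ∀ p ∈ S \ {u, v, w, t}, p = x ∨ p = y := by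
        rcases (S \ {u, v, w, t}).eq_empty_or_nonempty with he | ⟨x, hx⟩
        · exact ⟨u, hB.1.1, u, hB.1.1, by simp [he]⟩
        · have hd' : ((S \ {u, v, w, t}).erase x).card ≤ 1 := by
            rw [Finset.card_erase_of_mem hx]; omega
          rcases ((S \ {u, v, w, t}).erase x).eq_empty_or_nonempty with he | ⟨y, hy⟩
          · refine ⟨x, (Finset.mem_sdiff.1 hx).1, x, (Finset.mem_sdiff.1 hx).1, ?_⟩
            intro p hp
            by_contra hcc
            push Not at hcc
            have : p ∈ (S \ {u, v, w, t}).erase x := Finset.mem_erase.2 ⟨hcc.1, hp⟩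
            simp [he] at this
          · refine ⟨x, (Finset.mem_sdiff.1 hx).1, y,
              (Finset.mem_sdiff.1 (Finset.mem_erase.1 hy).2).1, ?_⟩
            intro p hp
            by_cases hpx : p = x
            · exact Or.inl hpx
            · exact Or.inr (Finset.card_le_one.1 hd' p (Finset.mem_erase.2 ⟨hpx, hp⟩) y hy)
      obtain ⟨x, hx, y, hy, hp⟩ := this
      refine CB_small hs hi ht hB hx hy ?_ (hA u v w t)
      intro p hpS
      by_contra hcc
      push Not at hcc
      rcases hp p (by simp [hpS, hcc]) with h | h
      · exact hcc.2.2.2.2.1 h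
      · exact hcc.2.2.2.2.2 h
  have hmul := Finset.card_le_mul_card_image (s := S.offDiag)
    (f := fun p => L A S p.1 p.2) (S.card - 1) (by
      intro b hb
      convert key b (by unfold lines; convert hb))
  rw [Finset.offDiag_card] at hmul
  have e : S.card * S.card - S.card = (S.card - 1) * S.card := by
    rw [Nat.sub_mul, one_mul]
  rw [e] at hmul
  have := Nat.le_of_mul_le_mul_left hmul (by omega)
  unfold lines
  convert this

open Classical in
theorem lift_card {T : Finset V} (hT : T ⊆ S) :
    (lines A T).card ≤ (T.offDiag.image (fun p => L A S p.1 p.2)).card := by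
  have : lines A T = (T.offDiag.image (fun p => L A S p.1 p.2)).image (fun K => K ∩ T) := by
    rw [Finset.image_image]
    unfold lines
    congr 1
    funext p
    ext q
    simp only [Function.comp, Finset.mem_inter, mem_L]
    have := @hT q
    tauto
  rw [this]
  exact Finset.card_image_le

theorem tw_iff (hs : ∀ x y, A x y → A y x) (hi : ∀ x, ¬ A x x) {u v a b : V}
    (hu : u ∈ S) (hv : v ∈ S) (huv : u ≠ v) (htw : ∀ w ∈ S, A u w ↔ A v w)
    (ha : a ∈ S) (hb : b ∈ S) (hav : a ≠ v) (hbv : b ≠ v)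
    (h1 : a = u → A u b) (h2 : b = u → A u a) : inL A a b u ↔ inL A a b v := by
  have t1 := htw a ha
  have t2 := htw b hb
  have t3 := htw u hu
  have t4 := htw v hv
  have e1 := hi u; have e2 := hi v
  have s1 := hs a b; have s2 := hs b a
  clear htw
  simp only [inL]
  by_cases p1 : a = u
  · subst p1
    have := h1 rfl
    simp_all
  · by_cases p2 : b = u
    · subst p2
      have := h2 rfl
      simp_all
    · simp only [Ne.symm hav, Ne.symm hbv, Ne.symm p1, Ne.symm p2, t1, t2, false_or]

theorem twin_good (hs : ∀ x y, A x y → A y x) (hi : ∀ x, ¬ A x x)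
    (ih : ∀ T, T ⊂ S → 2 ≤ T.card → Good A T) {u v : V}
    (hu : u ∈ S) (hv : v ∈ S) (huv : u ≠ v) (htw : ∀ w ∈ S, A u w ↔ A v w) : Good A S := by
  classical
  by_contra hG
  have hU : ¬ ∃ u ∈ S, ∃ v ∈ S, u ≠ v ∧ ∀ p ∈ S, inL A u v p := fun h => hG (Or.inr h)
  have huv' : ¬ A u v := fun h => hi v ((htw v hv).1 h)
  have hvu' : ¬ A v u := fun h => huv' (hs _ _ h)
  have hsy : ∀ x y, A x y ↔ A y x := fun x y => ⟨hs x y, hs y x⟩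
  have hy : ∃ y ∈ S, y ≠ u ∧ y ≠ v ∧ ¬ A u y := by
    by_contra hc
    push Not at hc
    apply hU
    refine ⟨u, hu, v, hv, huv, fun p hp => ?_⟩
    simp only [inL]
    by_cases p1 : p = u
    · exact Or.inl p1
    by_cases p2 : p = v
    · exact Or.inr (Or.inl p2)
    have h1 := hc p hp p1 p2
    exact Or.inr (Or.inr (Or.inr ⟨huv', hs _ _ h1, hs _ _ ((htw p hp).1 h1)⟩))
  obtain ⟨y, hyS, hyu, hyv, hAy⟩ := hy
  have hTS : S.erase v ⊂ S := Finset.erase_ssubset hv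
  have hTc : (S.erase v).card = S.card - 1 := Finset.card_erase_of_mem hv
  have hT2 : 2 ≤ (S.erase v).card := by
    rw [← Finset.card_pair hyu]
    apply Finset.card_le_card
    intro p hp
    simp only [Finset.mem_insert, Finset.mem_singleton] at hp
    rcases hp with rfl | rfl <;> simp [*]
  rcases ih _ hTS hT2 with hl | ⟨a, ha, b, hb, hab, huni⟩
  · apply hG
    left
    set K := (S.erase v).offDiag.image (fun p => L A S p.1 p.2) with hK
    have hKc : (lines A (S.erase v)).card ≤ K.card := lift_card hTS.1
    have hKs : K ⊆ lines A S := by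
      unfold lines
      exact Finset.image_subset_image (Finset.offDiag_mono hTS.1)
    have hnot : L A S v y ∉ K := by
      intro hmem
      obtain ⟨⟨a, b⟩, hab, heq⟩ := Finset.mem_image.1 hmem
      simp only [Finset.mem_offDiag, Finset.mem_erase] at hab heq
      have i1 := (L_eq heq v hv).2 (by simp [inL])
      have i2 : ¬ inL A a b u := by
        rw [L_eq heq u hu]
        have := htw y hyS
        simp only [inL]
        simp_all
        tauto
      apply i2
      rw [tw_iff hs hi hu hv huv htw hab.1.2 hab.2.1.2 hab.1.1 hab.2.1.1]
      · exact i1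
      · rintro rfl; exact absurd (by simp [inL]) i2
      · rintro rfl; exact absurd (by simp [inL]) i2
    have h1 := Finset.card_le_card (Finset.insert_subset
      (mem_lines.2 ⟨v, hv, y, hyS, Ne.symm hyv, rfl⟩) hKs)
    rw [Finset.card_insert_of_notMem hnot] at h1
    omega
  · have hva : ¬ inL A a b v := by
      intro h
      refine hU ⟨a, (Finset.mem_erase.1 ha).2, b, (Finset.mem_erase.1 hb).2, hab, fun p hp => ?_⟩
      by_cases hpv : p = v
      · rw [hpv]; exact h
      · exact huni p (Finset.mem_erase.2 ⟨hpv, hp⟩)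
    have hex : ∃ z ∈ S, z ≠ u ∧ z ≠ v ∧ ¬ A u z ∧ ∀ p ∈ S.erase v, inL A u z p := by
      have hua := huni u (Finset.mem_erase.2 ⟨huv, hu⟩)
      rw [Finset.mem_erase] at ha hb
      have := mt (tw_iff hs hi hu hv huv htw ha.2 hb.2 ha.1 hb.1 · )
      by_cases c1 : a = u ∧ ¬ A u b
      · obtain ⟨rfl, c2⟩ := c1
        exact ⟨b, hb.2, hab.symm, hb.1, c2, huni⟩
      by_cases c2 : b = u ∧ ¬ A u a
      · obtain ⟨rfl, c2⟩ := c2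
        refine ⟨a, ha.2, hab, ha.1, c2, fun p hp => ?_⟩
        have := huni p hp
        have h1 := hsy a b
        simp only [inL] at this ⊢
        clear * - this h1
        tauto
      exfalso
      apply hva
      rw [← tw_iff hs hi hu hv huv htw ha.2 hb.2 ha.1 hb.1]
      · exact hua
      · intro h; by_contra h'; exact c1 ⟨h, h'⟩
      · intro h; by_contra h'; exact c2 ⟨h, h'⟩
    obtain ⟨z, hz, hzu, hzv, hAz, huz⟩ := hex
    have hall : ∀ p ∈ S, p ≠ u → p ≠ v → p ≠ z → A p u ∧ A p z := by
      intro p hp p1 p2 p3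
      have := huz p (Finset.mem_erase.2 ⟨p2, hp⟩)
      simp only [inL] at this
      tauto
    have hAzu : ¬ A z u := fun h => hAz (hs _ _ h)
    have hAvz : ¬ A v z := fun h => hAz ((htw z hz).2 h)
    have hAzv : ¬ A z v := fun h => hAvz (hs _ _ h)
    have htw2 : ∀ p ∈ S, A u p ↔ A z p := by
      intro p hp
      by_cases p1 : p = u
      · subst p1; exact iff_of_false (hi _) hAzu
      by_cases p2 : p = v
      · subst p2; exact iff_of_false huv' hAzv
      by_cases p3 : p = z
      · subst p3; exact iff_of_false hAz (hi _)
      have := hall p hp p1 p2 p3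
      exact iff_of_true (hs _ _ this.1) (hs _ _ this.2)
    set T := (S.erase v).erase z with hT
    have hTS2 : T ⊂ S := (Finset.erase_subset _ _).trans_ssubset hTS
    have hTcard : T.card = S.card - 2 := by
      rw [hT, Finset.card_erase_of_mem (Finset.mem_erase.2 ⟨hzv, hz⟩), hTc]
      omega
    have mT : ∀ p, p ∈ T ↔ p ≠ z ∧ p ≠ v ∧ p ∈ S := by
      intro p; rw [hT, Finset.mem_erase, Finset.mem_erase]
    clear_value T
    have both : ∀ a ∈ T, ∀ b ∈ T, a ≠ b →
        (inL A a b u ↔ inL A a b v) ∧ (inL A a b u ↔ inL A a b z) := by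
      intro a ha b hb hab
      rw [mT] at ha hb
      have g1 : a = u → A u b := by
        rintro rfl
        exact hs _ _ (hall b hb.2.2 hab.symm hb.2.1 hb.1).1
      have g2 : b = u → A u a := by
        rintro rfl
        exact hs _ _ (hall a ha.2.2 hab ha.2.1 ha.1).1
      exact ⟨tw_iff hs hi hu hv huv htw ha.2.2 hb.2.2 ha.2.1 hb.2.1 g1 g2,
        tw_iff hs hi hu hz hzu.symm htw2 ha.2.2 hb.2.2 ha.1 hb.1 g1 g2⟩
    set K := T.offDiag.image (fun p => L A S p.1 p.2) with hK
    have hKc : T.card ≤ K.card + 1 := by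
      by_cases h2 : 2 ≤ T.card
      · rcases ih T hTS2 h2 with h | ⟨a, ha, b, hb, hab, h⟩
        · have := lift_card (A := A) hTS2.1
          have h3 : (lines A T).card ≤ K.card := this
          omega
        · exfalso
          have h4 := both a ha b hb hab
          have h5 := h u ((mT u).2 ⟨hzu.symm, huv, hu⟩)
          refine hU ⟨a, ((mT a).1 ha).2.2, b, ((mT b).1 hb).2.2, hab, fun p hp => ?_⟩
          by_cases p1 : p = v
          · rw [p1]; exact h4.1.1 h5
          by_cases p2 : p = z
          · rw [p2]; exact h4.2.1 h5
          exact h p ((mT p).2 ⟨p2, p1, hp⟩)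
      · omega
    have hKs : K ⊆ lines A S := by
      unfold lines
      exact Finset.image_subset_image (Finset.offDiag_mono hTS2.1)
    have hKp : ∀ M ∈ K, (u ∈ M ↔ v ∈ M) ∧ (u ∈ M ↔ z ∈ M) := by
      intro M hM
      obtain ⟨⟨a, b⟩, hab, rfl⟩ := Finset.mem_image.1 hM
      simp only [Finset.mem_offDiag] at hab
      have := both a hab.1 b hab.2.1 hab.2.2
      simpa [mem_L, hu, hv, hz] using this
    have m1 : u ∈ L A S u v ∧ v ∈ L A S u v ∧ z ∉ L A S u v := by
      simp only [mem_L, inL]; simp_all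
    have m2 : u ∈ L A S u z ∧ v ∉ L A S u z ∧ z ∈ L A S u z := by
      simp only [mem_L, inL]
      have := huv.symm; have := hzv.symm
      simp_all
    have m3 : u ∉ L A S v z ∧ v ∈ L A S v z ∧ z ∈ L A S v z := by
      simp only [mem_L, inL]
      have := hzu.symm
      simp_all
    have n1 : L A S u v ∉ K := fun h => m1.2.2 ((hKp _ h).2.1 m1.1)
    have n2 : L A S u z ∉ insert (L A S u v) K := by
      rw [Finset.mem_insert]
      rintro (h | h)
      · exact m2.2.1 (h ▸ m1.2.1)
      · exact m2.2.1 ((hKp _ h).1.1 m2.1)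
    have n3 : L A S v z ∉ insert (L A S u z) (insert (L A S u v) K) := by
      rw [Finset.mem_insert, Finset.mem_insert]
      rintro (h | h | h)
      · exact m3.1 (h ▸ m2.1)
      · exact m3.1 (h ▸ m1.1)
      · exact m3.1 ((hKp _ h).1.2 m3.2.1)
    have hsub : insert (L A S v z) (insert (L A S u z) (insert (L A S u v) K)) ⊆ lines A S := by
      refine Finset.insert_subset (mem_lines.2 ⟨v, hv, z, hz, hzv.symm, rfl⟩) ?_
      refine Finset.insert_subset (mem_lines.2 ⟨u, hu, z, hz, hzu.symm, rfl⟩) ?_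
      exact Finset.insert_subset (mem_lines.2 ⟨u, hu, v, hv, huv, rfl⟩) hKs
    have hc := Finset.card_le_card hsub
    rw [Finset.card_insert_of_notMem n3, Finset.card_insert_of_notMem n2,
      Finset.card_insert_of_notMem n1] at hc
    exact hG (Or.inl (by omega))

theorem good_all (hs : ∀ x y, A x y → A y x) (hi : ∀ x, ¬ A x x) (S : Finset V) :
    2 ≤ S.card → Good A S := by
  induction S using Finset.strongInduction with
  | H S ih =>
    intro hn
    by_cases ht : TwinFree A S
    · exact twinfree_good hs hi ht hn
    · unfold TwinFree at ht
      push Not at ht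
      obtain ⟨u, hu, v, hv, huv, h⟩ := ht
      exact twin_good hs hi ih hu hv huv h

end
end OT

theorem line_iff {α : Type*} [MetricSpace α] (h12 : OneTwo α) {u v : α} (huv : u ≠ v) (p : α) :
    p ∈ line u v ↔ OT.inL (fun x y : α => dist x y = 1) u v p := by
  simp only [OT.inL]
  change (_ ∨ _ ∨ _) ↔ _
  by_cases p1 : p = u
  · subst p1; simp
  by_cases p2 : p = v
  · subst p2; simp
  have c1 := dist_comm p u
  have c2 := dist_comm p v
  rw [dist_comm u p, dist_comm v p]
  rcases h12 u v huv with h | h <;> rcases h12 p u p1 with h' | h' <;>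
    rcases h12 p v p2 with h'' | h'' <;> rw [h, h', h''] <;> norm_num [p1, p2]

theorem stmt0 (α : Type*) [MetricSpace α] [Fintype α]
    (h12 : OneTwo α) (hn : 2 ≤ Fintype.card α) :
    Fintype.card α ≤ (linesOf α).ncard ∨
      ∃ u v : α, u ≠ v ∧ line u v = Set.univ := by
  classical
  have hL : ∀ u v : α, u ≠ v →
      ((OT.L (fun x y : α => dist x y = 1) Finset.univ u v : Finset α) : Set α) = line u v := by
    intro u v huv
    ext p
    rw [Finset.mem_coe, OT.mem_L, line_iff h12 huv]
    simp
  rcases OT.good_all (A := fun x y : α => dist x y = 1)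
    (fun x y h => by rw [dist_comm]; exact h) (fun x => by simp) Finset.univ
    (by rwa [Finset.card_univ]) with h | ⟨u, -, v, -, huv, h⟩
  · left
    rw [Finset.card_univ] at h
    refine h.trans ?_
    rw [← Set.ncard_coe_finset, ← Set.ncard_image_of_injective (f := fun s : Finset α => (s : Set α))
      _ Finset.coe_injective]
    apply Set.ncard_le_ncard _ (Set.toFinite _)
    rintro _ ⟨T, hT, rfl⟩
    obtain ⟨u, -, v, -, huv, rfl⟩ := OT.mem_lines.1 (Finset.mem_coe.1 hT)
    exact ⟨u, v, huv, hL u v huv⟩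
  · right
    refine ⟨u, v, huv, ?_⟩
    ext p
    simp [line_iff h12 huv, h p (Finset.mem_univ p)]
end

section
/- Every 1-2 metric space on 8 points either has at least 8 distinct lines or has a universal line. -/
/- The proof encodes the space as a graph (adjacent = distance one) and runs a verified search
that adds the points one at a time, keeping for the remaining points the list of those
neighbourhood masks that do not already produce eight lines.
-/

namespace OT

/-- line of two vertices, each given as (own bit, neighbourhood mask) -/
def ln (x y : ℕ × ℕ) : ℕ :=
  x.1 ||| (y.1 ||| (bif Nat.beq (x.2 &&& y.1) 0 then x.2 &&& y.2 else x.2 ^^^ y.2))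

/-- all lines of a graph -/
def pairs : List (ℕ × ℕ) → List ℕ
  | [] => []
  | x :: xs => xs.map (ln x) ++ pairs xs

def mem (a : ℕ) : List ℕ → Bool
  | [] => false
  | x :: xs => bif Nat.beq x a then true else mem a xs

def nub : List ℕ → List ℕ
  | [] => []
  | x :: xs => bif mem x xs then nub xs else x :: nub xs

/-- add to each old row the bit `b` of the new vertex, if the mask `s` says so -/
def ext (b s : ℕ) (R : List (ℕ × ℕ)) : List (ℕ × ℕ) :=
  R.map (fun x => (x.1, bif Nat.beq (s &&& x.1) 0 then x.2 else x.2 ||| b)) ++ [(b, s)]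

/-- evaluates a number before it is used -/
def force {β : Type} (k : ℕ → β) : ℕ → β
  | 0 => k 0
  | m + 1 => k (m + 1)

/-- evaluates a list before it is used -/
def forceL {β : Type} : List ℕ → (List ℕ → β) → β
  | [], k => k []
  | x :: xs, k => force (fun y => forceL xs fun ys => k (y :: ys)) x

def forceP {β : Type} : List (ℕ × ℕ) → (List (ℕ × ℕ) → β) → β
  | [], k => k []
  | x :: xs, k => force (fun y => force (fun z => forceP xs fun ys => k ((y, z) :: ys)) x.2) x.1

def ok (n s : ℕ) (R : List (ℕ × ℕ)) : Bool :=
  forceP (ext (2 ^ n) s R) fun R' =>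
  forceL (pairs R') fun L =>
  bif Nat.ble 8 (nub L).length then false else
  bif Nat.beq n 7 then !(mem 255 L) else true

/-- either some remaining point has mask `s`, or none has and `s` is dropped -/
def loop (g : ℕ → List ℕ → Bool) : List ℕ → Bool
  | [] => true
  | s :: C => bif g s (s :: C) then loop g C else false

def search : ℕ → ℕ → List (ℕ × ℕ) → List ℕ → Bool
  | 0, _, _, _ => false
  | f + 1, n, R, C => loop (fun s D =>
      forceP (ext (2 ^ n) s R) fun R' =>
      forceL ((D ++ D.map (fun t => t ||| 2 ^ n)).filter (fun t => ok (n + 1) t R')) fun D' =>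
      search f (n + 1) R' D') C

theorem force_eq {β : Type} (k : ℕ → β) (n : ℕ) : force k n = k n := by
  cases n <;> rfl

theorem forceL_eq {β : Type} (L : List ℕ) (k : List ℕ → β) : forceL L k = k L := by
  induction L generalizing k with
  | nil => rfl
  | cons x xs ih => rw [forceL, force_eq, ih]

theorem forceP_eq {β : Type} (L : List (ℕ × ℕ)) (k : List (ℕ × ℕ) → β) :
    forceP L k = k L := by
  induction L generalizing k with
  | nil => rfl
  | cons x xs ih => rw [forceP, force_eq, force_eq, ih]

theorem search_true : search 8 0 [] [0] = true := by decide +kernel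

def mask (p : ℕ → Bool) : ℕ → ℕ
  | 0 => 0
  | n + 1 => bif p n then mask p n ||| 2 ^ n else mask p n

theorem testBit_mask (p : ℕ → Bool) (n j : ℕ) :
    (mask p n).testBit j = (decide (j < n) && p j) := by
  induction n with
  | zero => simp [mask]
  | succ n ih =>
    have key : decide (j < n + 1) = (decide (j < n) || decide (n = j)) := by
      rw [Bool.eq_iff_iff]; simp; omega
    rw [mask, key]
    by_cases h : n = j
    · subst h; cases hp : p n <;> simp [ih, hp, Nat.testBit_two_pow_self]
    · cases hp : p n <;> simp [ih, h]

theorem mask_congr {p q : ℕ → Bool} {n : ℕ} (h : ∀ j < n, p j = q j) :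
    mask p n = mask q n := by
  apply Nat.eq_of_testBit_eq
  intro j
  rw [testBit_mask, testBit_mask]
  by_cases hj : j < n
  · simp [h j hj]
  · simp [hj]

theorem and_pow_beq (a i : ℕ) : Nat.beq (a &&& 2 ^ i) 0 = !(a.testBit i) := by
  rw [Nat.and_two_pow]
  cases a.testBit i
  · simp
  · have : 2 ^ i ≠ 0 := by positivity
    rw [Bool.toNat_true, Nat.one_mul, Bool.not_true, Bool.eq_false_iff]
    exact fun h => this (Nat.eq_of_beq_eq_true h)

theorem mem_iff (a : ℕ) (L : List ℕ) : mem a L = true ↔ a ∈ L := by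
  induction L with
  | nil => simp [mem]
  | cons x xs ih =>
    rw [mem, List.mem_cons, ← ih]
    cases h : Nat.beq x a
    · have : a ≠ x := by rintro rfl; simp at h
      simp [this]
    · have := Nat.eq_of_beq_eq_true h
      simp [this]

theorem nub_sub (L : List ℕ) : ∀ a ∈ nub L, a ∈ L := by
  induction L with
  | nil => simp [nub]
  | cons x xs ih =>
    intro a ha
    rw [nub] at ha
    cases h : mem x xs <;> simp only [h, cond_true, cond_false, List.mem_cons] at ha ⊢
    · exact ha.imp id (ih a)
    · exact Or.inr (ih a ha)

theorem nub_nodup (L : List ℕ) : (nub L).Nodup := by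
  induction L with
  | nil => simp [nub]
  | cons x xs ih =>
    rw [nub]
    cases h : mem x xs <;> simp only [cond_true, cond_false]
    · refine List.nodup_cons.2 ⟨fun hx => ?_, ih⟩
      have := (mem_iff x xs).2 (nub_sub _ _ hx)
      simp [this] at h
    · exact ih

section
variable {α : Type*} [MetricSpace α]

open Classical in
/-- adjacency along an enumeration -/
noncomputable def adj (e : ℕ → α) (i j : ℕ) : Bool := decide (dist (e i) (e j) = 1)

noncomputable def rows (e : ℕ → α) (n : ℕ) : List (ℕ × ℕ) :=
  (List.range n).map fun i => (2 ^ i, mask (adj e i) n)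

theorem adj_symm (e : ℕ → α) (i j : ℕ) : adj e i j = adj e j i := by
  simp [adj, dist_comm]

theorem adj_self (e : ℕ → α) (i : ℕ) : adj e i i = false := by
  simp [adj]

theorem ext_rows (e : ℕ → α) (n : ℕ) :
    ext (2 ^ n) (mask (adj e n) n) (rows e n) = rows e (n + 1) := by
  rw [ext, rows, rows, List.range_succ, List.map_append, List.map_map]
  congr 1
  · apply List.map_congr_left
    intro i hi
    rw [List.mem_range] at hi
    simp only [Function.comp, and_pow_beq, testBit_mask, hi, decide_true, Bool.true_and, mask]
    rw [adj_symm e n i]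
    cases adj e i n <;> simp
  · simp [mask, adj_self]

/-- an enumeration of the eight points -/
structure Enum (e : ℕ → α) : Prop where
  inj : ∀ i < 8, ∀ j < 8, e i = e j → i = j
  surj : ∀ x, ∃ i < 8, e i = x

theorem mem_line (h12 : OneTwo α) {e : ℕ → α} (he : Enum e) {i j k : ℕ}
    (hi : i < 8) (hj : j < 8) (hk : k < 8) (hij : i ≠ j) :
    e k ∈ line (e i) (e j) ↔
      (k = i ∨ k = j ∨ (bif adj e i j then xor (adj e i k) (adj e j k)
        else (adj e i k && adj e j k)) = true) := by
  have hne : e i ≠ e j := fun h => hij (he.inj _ hi _ hj h)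
  by_cases hki : k = i
  · subst hki; simp [line]
  by_cases hkj : k = j
  · subst hkj; simp [line]
  have h1 : e i ≠ e k := fun h => hki (he.inj _ hi _ hk h).symm
  have h2 : e j ≠ e k := fun h => hkj (he.inj _ hj _ hk h).symm
  simp only [line, Set.mem_ofPred_eq, adj, hki, hkj, false_or, dist_comm (e k)]
  rcases h12 _ _ hne with a | a <;> rcases h12 _ _ h1 with b | b <;>
    rcases h12 _ _ h2 with c | c <;> rw [a, b, c] <;> norm_num

theorem mem_pairs (L : List (ℕ × ℕ)) (a : ℕ) (h : a ∈ pairs L) (hL : L.Nodup) :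
    ∃ x ∈ L, ∃ y ∈ L, x ≠ y ∧ a = ln x y := by
  induction L with
  | nil => simp [pairs] at h
  | cons x xs ih =>
    rw [List.nodup_cons] at hL
    rw [pairs, List.mem_append, List.mem_map] at h
    rcases h with ⟨y, hy, rfl⟩ | h
    · exact ⟨x, by simp, y, by simp [hy], fun h => hL.1 (h ▸ hy), rfl⟩
    · obtain ⟨u, hu, v, hv, h⟩ := ih h hL.2
      exact ⟨u, by simp [hu], v, by simp [hv], h⟩

open Classical in
noncomputable def enc (e : ℕ → α) (n : ℕ) (S : Set α) : ℕ :=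
  mask (fun k => decide (e k ∈ S)) n

theorem rows_nodup (e : ℕ → α) (n : ℕ) : (rows e n).Nodup := by
  apply List.Nodup.map _ List.nodup_range
  intro i j h
  simp only [Prod.mk.injEq] at h
  exact Nat.pow_right_injective (le_refl 2) h.1

theorem pairs_rows (h12 : OneTwo α) {e : ℕ → α} (he : Enum e) {n : ℕ} (hn : n ≤ 8)
    (a : ℕ) (h : a ∈ pairs (rows e n)) :
    ∃ u v : α, u ≠ v ∧ a = enc e n (line u v) := by
  obtain ⟨x, hx, y, hy, hxy, rfl⟩ := mem_pairs _ _ h (rows_nodup e n)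
  simp only [rows, List.mem_map, List.mem_range] at hx hy
  obtain ⟨i, hi, rfl⟩ := hx
  obtain ⟨j, hj, rfl⟩ := hy
  have hij : i ≠ j := by rintro rfl; exact hxy rfl
  refine ⟨e i, e j, fun h => hij (he.inj _ (by omega) _ (by omega) h), ?_⟩
  apply Nat.eq_of_testBit_eq
  intro k
  rw [enc, testBit_mask]
  simp only [ln, and_pow_beq, testBit_mask, hj, decide_true, Bool.true_and, Nat.testBit_or,
    Nat.testBit_two_pow]
  by_cases hk : k < n
  · rw [Bool.eq_iff_iff]
    simp only [hk, decide_true, Bool.true_and, decide_eq_true_eq]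
    rw [mem_line h12 he (by omega) (by omega) (by omega) hij]
    rw [eq_comm (a := k) (b := i), eq_comm (a := k) (b := j)]
    cases adj e i j <;> simp [testBit_mask, hk]
  · have h1 : i ≠ k := by omega
    have h2 : j ≠ k := by omega
    cases adj e i j <;> simp [testBit_mask, hk, h1, h2]

theorem ok_rows (h12 : OneTwo α) (hfin : Finite α) (hlt : (linesOf α).ncard < 8)
    (hun : ¬ ∃ u v : α, u ≠ v ∧ line u v = Set.univ)
    {e : ℕ → α} (he : Enum e) {n : ℕ} (hn : n < 8) :
    ok n (mask (adj e n) n) (rows e n) = true := by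
  rw [ok, forceP_eq, forceL_eq, ext_rows]
  have h1 : Nat.ble 8 (nub (pairs (rows e (n + 1)))).length = false := by
    by_contra hc
    rw [Bool.not_eq_false, Nat.ble_eq] at hc
    have hsub : ((nub (pairs (rows e (n + 1)))).toFinset : Set ℕ)
        ⊆ enc e (n + 1) '' linesOf α := by
      intro a ha
      simp only [List.coe_toFinset, Set.mem_ofPred_eq] at ha
      obtain ⟨u, v, huv, rfl⟩ := pairs_rows h12 he (by omega) a (nub_sub _ _ ha)
      exact ⟨_, ⟨u, v, huv, rfl⟩, rfl⟩
    have hf : (linesOf α).Finite := Set.toFinite _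
    have h2 := Set.ncard_le_ncard hsub (hf.image _)
    have h3 := Set.ncard_image_le (f := enc e (n + 1)) hf
    rw [Set.ncard_coe_finset, List.toFinset_card_of_nodup (nub_nodup _)] at h2
    omega
  rw [h1]
  simp only [cond_false]
  cases h7 : Nat.beq n 7
  · rfl
  have h7' : n = 7 := Nat.eq_of_beq_eq_true h7
  subst h7'
  simp only [cond_true, Bool.not_eq_true']
  by_contra hc
  rw [Bool.not_eq_false, mem_iff] at hc
  obtain ⟨u, v, huv, h⟩ := pairs_rows h12 he (by omega) _ hc
  refine hun ⟨u, v, huv, Set.eq_univ_of_forall fun x => ?_⟩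
  obtain ⟨k, hk, rfl⟩ := he.surj x
  have hb := congrArg (fun m => Nat.testBit m k) h
  simp only [enc, testBit_mask] at hb
  have h255 : Nat.testBit 255 k = true := by interval_cases k <;> decide
  rw [h255] at hb
  simpa [hk] using hb.symm

theorem enum_swap {e : ℕ → α} (he : Enum e) {i j : ℕ} (hi : i < 8) (hj : j < 8) :
    Enum (e ∘ Equiv.swap i j) := by
  have hs : ∀ k < 8, Equiv.swap i j k < 8 := by
    intro k hk
    rw [Equiv.swap_apply_def]
    split_ifs <;> assumption
  constructor
  · intro a ha b hb h
    exact (Equiv.swap i j).injective (he.inj _ (hs a ha) _ (hs b hb) h)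
  · intro x
    obtain ⟨k, hk, rfl⟩ := he.surj x
    exact ⟨_, hs k hk, by simp⟩

theorem swap_rows (e : ℕ → α) {n i : ℕ} (hi : n ≤ i) :
    mask (adj (e ∘ Equiv.swap n i) n) n = mask (adj e i) n ∧
      rows (e ∘ Equiv.swap n i) n = rows e n := by
  have hfix : ∀ k < n, (e ∘ Equiv.swap n i) k = e k := by
    intro k hk
    simp [Equiv.swap_apply_of_ne_of_ne (show k ≠ n by omega) (show k ≠ i by omega)]
  constructor
  · apply mask_congr
    intro k hk
    rw [adj, adj, hfix k hk]
    simp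
  · apply List.map_congr_left
    intro k hk
    rw [List.mem_range] at hk
    congr 1
    apply mask_congr
    intro l hl
    rw [adj, adj, hfix k hk, hfix l hl]

theorem swap_mask (e : ℕ → α) {n i : ℕ} (hi : n ≤ i) (hi8 : i < 8) (D : List ℕ)
    (hD : ∀ j, n ≤ j → j < 8 → mask (adj e j) n ∈ D) :
    ∀ j, n ≤ j → j < 8 → mask (adj (e ∘ Equiv.swap n i) j) n ∈ D := by
  intro j hj hj8
  have h1 : mask (adj (e ∘ Equiv.swap n i) j) n = mask (adj e (Equiv.swap n i j)) n := by
    apply mask_congr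
    intro k hk
    simp [adj, Equiv.swap_apply_of_ne_of_ne (show k ≠ n by omega) (show k ≠ i by omega)]
  rw [h1]
  apply hD <;> rw [Equiv.swap_apply_def] <;> split_ifs <;> omega

theorem search_sound (h12 : OneTwo α) (hfin : Finite α) (hlt : (linesOf α).ncard < 8)
    (hun : ¬ ∃ u v : α, u ≠ v ∧ line u v = Set.univ) (f : ℕ) :
    ∀ (e : ℕ → α) (_ : Enum e) (n : ℕ) (C : List ℕ), n + f = 8 →
    (∀ i, n ≤ i → i < 8 → mask (adj e i) n ∈ C) → search f n (rows e n) C = true → False := by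
  induction f with
  | zero => intro e he n C _ _ h; simp [search] at h
  | succ f ih =>
    intro e he n C hn hC h
    rw [search] at h
    simp only [forceP_eq, forceL_eq] at h
    induction C with
    | nil => simpa using hC n le_rfl (by omega)
    | cons s C ihC =>
      rw [loop, Bool.cond_false_right, Bool.and_eq_true] at h
      by_cases hs : ∃ i, n ≤ i ∧ i < 8 ∧ mask (adj e i) n = s
      · obtain ⟨i, hni, hi8, rfl⟩ := hs
        have h := h.1
        have hC' := swap_mask e hni hi8 _ hC
        have he' := enum_swap he (i := n) (j := i) (by omega) hi8
        obtain ⟨hr1, hr2⟩ := swap_rows e hni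
        rw [← hr1, ← hr2] at h
        rw [← hr1] at hC'
        generalize e ∘ Equiv.swap n i = e' at *
        rw [ext_rows] at h
        refine ih e' he' (n + 1) _ (by omega) ?_ h
        intro i hi hi8
        rw [List.mem_filter]
        refine ⟨?_, ?_⟩
        · have hm := hC' i (by omega) hi8
          rw [mask, List.mem_append, List.mem_map]
          cases adj e' i n
          · exact Or.inl hm
          · exact Or.inr ⟨_, hm, rfl⟩
        · have hok := ok_rows h12 hfin hlt hun
            (enum_swap he' (i := n + 1) (j := i) (by omega) hi8) (n := n + 1) (by omega)
          obtain ⟨h1, h2⟩ := swap_rows e' hi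
          rw [h1, h2] at hok
          exact hok
      · refine ihC ?_ h.2
        intro i hi hi8
        rcases List.mem_cons.1 (hC i hi hi8) with h' | h'
        · exact absurd ⟨i, hi, hi8, h'⟩ hs
        · exact h'

end

end OT

theorem stmt12 (α : Type*) [MetricSpace α] [Fintype α] (h12 : OneTwo α)
    (hn : Fintype.card α = 8) :
    8 ≤ (linesOf α).ncard ∨ ∃ u v : α, u ≠ v ∧ line u v = Set.univ := by
  by_contra hc
  rw [not_or, not_le] at hc
  obtain ⟨g⟩ : Nonempty (Fin 8 ≃ α) := ⟨(Fintype.equivFinOfCardEq hn).symm⟩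
  have he : OT.Enum (fun k : ℕ => g (Fin.ofNat 8 k)) := by
    constructor
    · intro i hi j hj h
      have h' := congrArg Fin.val (g.injective h)
      simp only [Fin.ofNat] at h'
      omega
    · intro x
      refine ⟨(g.symm x).val, (g.symm x).isLt, ?_⟩
      simp
  exact OT.search_sound h12 inferInstance hc.1 hc.2 8 _ he 0 [0] rfl
    (fun i _ _ => by simp [OT.mask]) OT.search_true
end

section
/- Every 1-2 metric space on 7 points in which every 1-2 metric space on fewer points has the De Bruijn–Erdős property, itself has at least 7 distinct lines or a universal line. -/
/-- Bit mask of a Boolean predicate on `0, …, k-1`. -/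
def mkMask (f : ℕ → Bool) : ℕ → ℕ
  | 0 => 0
  | k + 1 => Nat.add (mkMask f k) (cond (f k) (Nat.pow 2 k) 0)

/-- Apply `f` to `n`, evaluating `n` first. -/
noncomputable def force (n : ℕ) (f : ℕ → Bool) : Bool :=
  Nat.rec (f 0) (fun k _ => f (Nat.succ k)) n

/-- Mask of the line through `u`, `v` with neighbourhood masks `a`, `b`
and indicator masks `p = 2 ^ u`, `q = 2 ^ v`. -/
def lineMask (a p b q : ℕ) : ℕ :=
  cond (Nat.beq (Nat.land a q) 0) (Nat.lor (Nat.land a b) (Nat.lor p q)) (Nat.xor a b)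

noncomputable def memb (x : ℕ) (l : List ℕ) : Bool :=
  List.rec false (fun y _ ih => cond (Nat.beq x y) true ih) l

/-- Continuation-passing count of distinct values: `K acc n` is called after `x` is treated. -/
noncomputable def addMask (x : ℕ) (acc : List ℕ) (n : ℕ) (K : List ℕ → ℕ → Bool) : Bool :=
  force x fun x => cond (memb x acc) (K acc n)
    (Nat.rec true (fun n _ => K (x :: acc) n) n)

/-- Add all lines through the vertex with mask `a` and indicator `p` and a vertex in the list. -/
noncomputable def addStar (a p : ℕ) (rows : List (ℕ × ℕ)) :
    List ℕ → ℕ → (List ℕ → ℕ → Bool) → Bool :=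
  List.rec (fun acc n K => K acc n)
    (fun r _ ih acc n K => addMask (lineMask a p r.1 r.2) acc n fun acc n => ih acc n K) rows

noncomputable def addAll (rows : List (ℕ × ℕ)) : List ℕ → ℕ → Bool :=
  List.rec (fun _ _ => false)
    (fun r l ih acc n => addStar r.1 r.2 l acc n ih) rows

/-- Update rows for a new vertex of indicator `q` with neighbourhood mask `m`. -/
noncomputable def updRows (q m : ℕ) (rows : List (ℕ × ℕ)) : (List (ℕ × ℕ) → Bool) → Bool :=
  List.rec (fun K => K [])
    (fun r _ ih K => force (cond (Nat.beq (Nat.land m r.2) 0) r.1 (Nat.add r.1 q)) fun x =>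
      ih fun l => K ((x, r.2) :: l)) rows

noncomputable def allBelow (N : ℕ) (P : ℕ → Bool) : Bool :=
  Nat.rec true (fun m ih => cond (P m) ih false) N

/-- Every extension of the given graph to a larger one eventually has 7 distinct lines. -/
noncomputable def search (f : ℕ) : ℕ → List (ℕ × ℕ) → Bool :=
  Nat.rec (fun _ _ => false)
    (fun _ ih q rows => cond (addAll rows [] 6) true
      (allBelow q fun m => updRows q m rows fun l => ih (Nat.mul 2 q) ((m, q) :: l))) f

theorem search_true : search 8 1 [] = true := by
  decide +kernel

theorem force_eq (n : ℕ) (f : ℕ → Bool) : force n f = f n := by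
  cases n <;> rfl

theorem memb_iff (x : ℕ) (l : List ℕ) : memb x l = true ↔ x ∈ l := by
  induction l with
  | nil => simp [memb]
  | cons y l ih =>
    have h : memb x (y :: l) = cond (Nat.beq x y) true (memb x l) := rfl
    rw [h, List.mem_cons, ← ih]
    cases hb : Nat.beq x y
    · have : x ≠ y := fun h => by simp [h] at hb
      simp [this]
    · have : x = y := Nat.eq_of_beq_eq_true hb
      simp [this]

/-- Invariant of the accumulator. -/
def Good (T : Finset ℕ) (acc : List ℕ) (n : ℕ) : Prop :=
  acc.Nodup ∧ (∀ x ∈ acc, x ∈ T) ∧ acc.length + n = 6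

theorem addMask_sound (T : Finset ℕ) (x : ℕ) (hx : x ∈ T) (acc : List ℕ) (n : ℕ)
    (K : List ℕ → ℕ → Bool) (hg : Good T acc n)
    (hK : ∀ acc n, Good T acc n → K acc n = true → 7 ≤ T.card)
    (h : addMask x acc n K = true) : 7 ≤ T.card := by
  unfold addMask at h
  rw [force_eq] at h
  obtain ⟨h1, h2, h3⟩ := hg
  cases hb : memb x acc
  · have hn : x ∉ acc := by rw [← memb_iff]; simp [hb]
    have hnd : (x :: acc).Nodup := List.nodup_cons.2 ⟨hn, h1⟩
    have hsub : ∀ y ∈ x :: acc, y ∈ T := by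
      intro y hy
      rcases List.mem_cons.1 hy with rfl | hy
      · exact hx
      · exact h2 y hy
    rw [hb] at h
    cases n with
    | zero =>
      have h4 : (x :: acc).toFinset ⊆ T := fun y hy => hsub y (List.mem_toFinset.1 hy)
      have h5 := Finset.card_le_card h4
      rw [List.toFinset_card_of_nodup hnd, List.length_cons] at h5
      omega
    | succ n =>
      refine hK (x :: acc) n ⟨hnd, hsub, ?_⟩ h
      rw [List.length_cons]; omega
  · rw [hb] at h
    exact hK acc n ⟨h1, h2, h3⟩ h

theorem addStar_sound (T : Finset ℕ) (a p : ℕ) (rows : List (ℕ × ℕ))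
    (hr : ∀ r ∈ rows, lineMask a p r.1 r.2 ∈ T)
    (K : List ℕ → ℕ → Bool)
    (hK : ∀ acc n, Good T acc n → K acc n = true → 7 ≤ T.card) :
    ∀ acc n, Good T acc n → addStar a p rows acc n K = true → 7 ≤ T.card := by
  induction rows with
  | nil => exact hK
  | cons r l ih =>
    intro acc n hg h
    exact addMask_sound T _ (hr r (by simp)) acc n _ hg
      (ih fun s hs => hr s (by simp [hs])) h

theorem addAll_sound (T : Finset ℕ) (rows : List (ℕ × ℕ))
    (hr : rows.Pairwise fun r s => lineMask r.1 r.2 s.1 s.2 ∈ T) :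
    ∀ acc n, Good T acc n → addAll rows acc n = true → 7 ≤ T.card := by
  induction rows with
  | nil => intro acc n _ h; exact absurd h (by simp [addAll])
  | cons r l ih =>
    intro acc n hg h
    rw [List.pairwise_cons] at hr
    exact addStar_sound T r.1 r.2 l hr.1 (addAll l) (ih hr.2) acc n hg h

theorem updRows_eq (q m : ℕ) (rows : List (ℕ × ℕ)) (K : List (ℕ × ℕ) → Bool) :
    updRows q m rows K = K (rows.map fun r =>
      (cond (Nat.beq (Nat.land m r.2) 0) r.1 (Nat.add r.1 q), r.2)) := by
  induction rows generalizing K with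
  | nil => rfl
  | cons r l ih =>
    have h : updRows q m (r :: l) K =
      force (cond (Nat.beq (Nat.land m r.2) 0) r.1 (Nat.add r.1 q)) fun x =>
        updRows q m l fun l => K ((x, r.2) :: l) := rfl
    rw [h, force_eq, ih]
    rfl

theorem allBelow_sound (N : ℕ) (P : ℕ → Bool) (h : allBelow N P = true) :
    ∀ m < N, P m = true := by
  induction N with
  | zero => intro m hm; omega
  | succ N ih =>
    have h' : cond (P N) (allBelow N P) false = true := h
    cases hb : P N
    · simp [hb] at h'
    · rw [hb] at h'
      intro m hm
      rcases Nat.lt_succ_iff_lt_or_eq.1 hm with hm | rfl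
      · exact ih h' m hm
      · exact hb

theorem mkMask_lt (f : ℕ → Bool) (k : ℕ) : mkMask f k < 2 ^ k := by
  induction k with
  | zero => simp [mkMask]
  | succ k ih =>
    have h : mkMask f (k + 1) = mkMask f k + cond (f k) (2 ^ k) 0 := rfl
    rw [h, pow_succ]
    cases f k <;> simp <;> omega

theorem mkMask_testBit (f : ℕ → Bool) (k j : ℕ) :
    (mkMask f k).testBit j = (decide (j < k) && f j) := by
  induction k with
  | zero => simp [mkMask]
  | succ k ih =>
    have h : mkMask f (k + 1) = mkMask f k + cond (f k) (2 ^ k) 0 := rfl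
    have hlt := mkMask_lt f k
    rw [h]
    rcases lt_trichotomy j k with hj | hj | hj
    · have : j < k + 1 := by omega
      cases hf : f k
      · simp [ih, hj, this]
      · simp only [cond_true]
        rw [Nat.add_comm, Nat.testBit_two_pow_add_gt hj, ih]
        simp [hj, this]
    · subst hj
      cases hf : f j
      · simp [ih, hf]
      · simp only [cond_true]
        rw [Nat.add_comm, Nat.testBit_two_pow_add_eq, ih]
        simp
    · have h2 : mkMask f k + cond (f k) (2 ^ k) 0 < 2 ^ j := by
        have := mkMask_lt f (k + 1)
        rw [h] at this
        exact this.trans_le (Nat.pow_le_pow_right (by norm_num) hj)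
      rw [Nat.testBit_lt_two_pow h2]
      have : ¬ j < k + 1 := by omega
      simp [this]

theorem beq_land_pow (a j : ℕ) : Nat.beq (Nat.land a (2 ^ j)) 0 = !(a.testBit j) := by
  have h : Nat.land a (2 ^ j) = (a.testBit j).toNat * 2 ^ j := Nat.and_two_pow a j
  rw [h]
  cases a.testBit j
  · simp
  · have : (2 ^ j : ℕ) ≠ 0 := by positivity
    simp only [Bool.toNat_true, one_mul, Bool.not_true]
    exact Bool.eq_false_iff.2 fun h => this (Nat.eq_of_beq_eq_true h)

/-- The first `j` rows of the graph on `0, …, k-1`, in decreasing order. -/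
def rowsOf (A : ℕ → ℕ → Bool) (k : ℕ) : ℕ → List (ℕ × ℕ)
  | 0 => []
  | j + 1 => (mkMask (A j) k, 2 ^ j) :: rowsOf A k j

theorem mem_rowsOf (A : ℕ → ℕ → Bool) (k j : ℕ) (r : ℕ × ℕ) (hr : r ∈ rowsOf A k j) :
    ∃ i < j, r = (mkMask (A i) k, 2 ^ i) := by
  induction j with
  | zero => simp [rowsOf] at hr
  | succ j ih =>
    rcases List.mem_cons.1 hr with h | h
    · exact ⟨j, by omega, h⟩
    · obtain ⟨i, hi, h⟩ := ih h
      exact ⟨i, by omega, h⟩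

theorem rowsOf_map (A : ℕ → ℕ → Bool) (hs : ∀ i j, A i j = A j i) (k j : ℕ) (hj : j ≤ k) :
    (rowsOf A k j).map (fun r =>
      (cond (Nat.beq (Nat.land (mkMask (A k) k) r.2) 0) r.1 (Nat.add r.1 (2 ^ k)), r.2))
      = rowsOf A (k + 1) j := by
  induction j with
  | zero => rfl
  | succ j ih =>
    have hjk : j < k := hj
    have h : mkMask (A j) (k + 1) = mkMask (A j) k + cond (A j k) (2 ^ k) 0 := rfl
    simp only [rowsOf, List.map_cons, ih (by omega), beq_land_pow, mkMask_testBit, h, hs k j]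
    cases A j k <;> simp [hjk]

theorem mkMask_self (A : ℕ → ℕ → Bool) (hi : ∀ i, A i i = false) (k : ℕ) :
    mkMask (A k) (k + 1) = mkMask (A k) k := by
  have h : mkMask (A k) (k + 1) = mkMask (A k) k + cond (A k k) (2 ^ k) 0 := rfl
  simp [h, hi]

theorem search_sound (A : ℕ → ℕ → Bool) (hs : ∀ i j, A i j = A j i) (hi : ∀ i, A i i = false)
    (N : ℕ)
    (H : ∀ k ≤ 7, ∃ T : Finset ℕ, T.card ≤ N ∧
      (rowsOf A k k).Pairwise fun r s => lineMask r.1 r.2 s.1 s.2 ∈ T)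
    (f : ℕ) : ∀ k, f + k ≤ 8 → search f (2 ^ k) (rowsOf A k k) = true → 7 ≤ N := by
  induction f with
  | zero => intro k _ h; exact absurd h (by simp [search])
  | succ f ih =>
    intro k hk h
    have h' : cond (addAll (rowsOf A k k) [] 6) true
      (allBelow (2 ^ k) fun m => updRows (2 ^ k) m (rowsOf A k k) fun l =>
        search f (Nat.mul 2 (2 ^ k)) ((m, 2 ^ k) :: l)) = true := h
    cases hb : addAll (rowsOf A k k) [] 6
    · rw [hb] at h'
      have h2 := allBelow_sound _ _ h' (mkMask (A k) k) (mkMask_lt _ _)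
      rw [updRows_eq, rowsOf_map A hs k k le_rfl] at h2
      refine ih (k + 1) (by omega) ?_
      have e : 2 ^ (k + 1) = Nat.mul 2 (2 ^ k) := by
        rw [pow_succ, mul_comm]; rfl
      rw [e]
      simpa only [rowsOf, mkMask_self A hi] using h2
    · obtain ⟨T, hT, hp⟩ := H k (by omega)
      exact (addAll_sound T _ hp [] 6 ⟨by simp, by simp, by simp⟩ hb).trans hT

theorem mem_line_one {α : Type} [MetricSpace α] (h12 : OneTwo α) (u v p : α)
    (h : dist u v = 1) : p ∈ line u v ↔ ¬ (dist u p = 1 ↔ dist v p = 1) := by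
  have hvu : dist v u = 1 := by rw [dist_comm]; exact h
  unfold line
  rw [Set.mem_ofPred_eq]
  by_cases hu : p = u
  · subst hu; simp [h, hvu]
  by_cases hv : p = v
  · subst hv; simp [h]
  rw [dist_comm p u, dist_comm p v, h]
  rcases h12 u p (Ne.symm hu) with h1 | h1 <;> rcases h12 v p (Ne.symm hv) with h2 | h2 <;>
    rw [h1, h2] <;> norm_num

theorem mem_line_two {α : Type} [MetricSpace α] (h12 : OneTwo α) (u v p : α)
    (h : dist u v = 2) :
    p ∈ line u v ↔ (dist u p = 1 ∧ dist v p = 1) ∨ p = u ∨ p = v := by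
  have hvu : dist v u = 2 := by rw [dist_comm]; exact h
  unfold line
  rw [Set.mem_ofPred_eq]
  by_cases hu : p = u
  · subst hu; simp [h]
  by_cases hv : p = v
  · subst hv; simp [h]
  rw [dist_comm p u, dist_comm p v, h]
  rcases h12 u p (Ne.symm hu) with h1 | h1 <;> rcases h12 v p (Ne.symm hv) with h2 | h2 <;>
    rw [h1, h2] <;> norm_num [hu, hv]

open Classical in
theorem lineMask_eq {α : Type} [MetricSpace α] (h12 : OneTwo α) (e : ℕ → α)
    (he : ∀ i < 7, ∀ j < 7, e i = e j → i = j) (A : ℕ → ℕ → Bool)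
    (hA : ∀ i j, A i j = decide (dist (e i) (e j) = 1))
    (k : ℕ) (hk : k ≤ 7) (u v : ℕ) (hu : u < k) (hv : v < k) (huv : u ≠ v) :
    lineMask (mkMask (A u) k) (2 ^ u) (mkMask (A v) k) (2 ^ v) =
      mkMask (fun p => decide (e p ∈ line (e u) (e v))) k := by
  have hne : e u ≠ e v := fun h => huv (he u (by omega) v (by omega) h)
  unfold lineMask
  rw [beq_land_pow, mkMask_testBit]
  apply Nat.eq_of_testBit_eq
  intro j
  rw [mkMask_testBit]
  rcases h12 _ _ hne with h | h
  · have : A u v = true := by rw [hA]; simp [h]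
    simp only [this, hv, decide_true, Bool.and_self, Bool.not_true, cond_false]
    change (mkMask (A u) k ^^^ mkMask (A v) k).testBit j = _
    rw [Nat.testBit_xor, mkMask_testBit, mkMask_testBit, hA, hA]
    by_cases hj : j < k
    · have := mem_line_one h12 (e u) (e v) (e j) h
      by_cases h1 : dist (e u) (e j) = 1 <;> by_cases h2 : dist (e v) (e j) = 1 <;>
        simp [this, h1, h2, hj]
    · simp [hj]
  · have : A u v = false := by rw [hA]; simp [h]
    simp only [this, Bool.and_false, Bool.not_false, cond_true]
    change ((mkMask (A u) k &&& mkMask (A v) k) ||| (2 ^ u ||| 2 ^ v)).testBit j = _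
    rw [Nat.testBit_or, Nat.testBit_or, Nat.testBit_and, mkMask_testBit, mkMask_testBit, hA, hA,
      Nat.testBit_two_pow, Nat.testBit_two_pow]
    by_cases hj : j < k
    · have := mem_line_two h12 (e u) (e v) (e j) h
      have e1 : e j = e u ↔ u = j :=
        ⟨fun h => he u (by omega) j (by omega) h.symm, fun h => by rw [h]⟩
      have e2 : e j = e v ↔ v = j :=
        ⟨fun h => he v (by omega) j (by omega) h.symm, fun h => by rw [h]⟩
      rw [e1, e2] at this
      simp [this, hj]
    · have h1 : u ≠ j := by omega
      have h2 : v ≠ j := by omega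
      simp [hj, h1, h2]

theorem rowsOf_pairwise (A : ℕ → ℕ → Bool) (k : ℕ) (R : ℕ × ℕ → ℕ × ℕ → Prop)
    (h : ∀ u < k, ∀ v < u, R (mkMask (A u) k, 2 ^ u) (mkMask (A v) k, 2 ^ v)) :
    ∀ j ≤ k, (rowsOf A k j).Pairwise R := by
  intro j
  induction j with
  | zero => intro _; exact List.Pairwise.nil
  | succ j ih =>
    intro hj
    refine List.pairwise_cons.2 ⟨?_, ih (by omega)⟩
    intro r hr
    obtain ⟨i, hi, rfl⟩ := mem_rowsOf A k j r hr
    exact h j hj i hi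

theorem stmt13 (α : Type) [MetricSpace α] [Fintype α] (h12 : OneTwo α)
    (hn : Fintype.card α = 7)
    (hsmall : ∀ (β : Type) [MetricSpace β] [Fintype β], OneTwo β →
      2 ≤ Fintype.card β → Fintype.card β < 7 →
      Fintype.card β ≤ (linesOf β).ncard ∨
        ∃ u v : β, u ≠ v ∧ line u v = Set.univ) :
    7 ≤ (linesOf α).ncard ∨ ∃ u v : α, u ≠ v ∧ line u v = Set.univ := by
  classical
  left
  let g : Fin 7 ≃ α := (Fintype.equivFinOfCardEq hn).symm
  let e : ℕ → α := fun i => if h : i < 7 then g ⟨i, h⟩ else g 0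
  have he : ∀ i < 7, ∀ j < 7, e i = e j → i = j := by
    intro i hi j hj h
    simp only [e, hi, hj, dif_pos] at h
    simpa using g.injective h
  let A : ℕ → ℕ → Bool := fun i j => decide (dist (e i) (e j) = 1)
  refine search_sound A (fun i j => ?_) (fun i => ?_) _ ?_ 8 0 le_rfl search_true
  · simp only [A, dist_comm]
  · simp [A]
  · intro k hk
    have hfin : (linesOf α).Finite := Set.toFinite _
    refine ⟨hfin.toFinset.image (fun S => mkMask (fun p => decide (e p ∈ S)) k), ?_, ?_⟩
    · rw [Set.ncard_eq_toFinset_card _ hfin]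
      exact Finset.card_image_le
    · refine rowsOf_pairwise A k _ ?_ k le_rfl
      intro u hu v hv
      rw [lineMask_eq h12 e he A (fun _ _ => rfl) k hk u v hu (by omega) (by omega)]
      refine Finset.mem_image_of_mem _ (hfin.mem_toFinset.2 ⟨e u, e v, ?_, rfl⟩)
      intro h
      have := he u (by omega) v (by omega) h
      omega
end
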